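/- arXiv:2012.07365 — 7 statements merged into one kernel-verified Lean document; each statement's English description precedes it below -/
import Mathlib

section
/- Let B be a noetherian separated scheme whose underlying topological space has Krull dimension 1, let z ∈ B be a closed point, and let U = B \ {z}. Let f : X ⟶ B be a morphism of schemes of finite type with X irreducible, such that the fiber f⁻¹(z) is nonempty and the open subset f⁻¹(U) is dense in X. Suppose there exists d ∈ ℕ such that for every σ ∈ U with f⁻¹(σ) nonempty, every irreducible component of the subspace f⁻¹(σ) has Krull dimension d. Then X is equidimensional over B: for every σ ∈ B with f⁻¹(σ) nonempty (in particular for σ = z), every irreducible component of the subspace f⁻¹(σ) has Krull dimension d. (Lemma 8.1) -/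
open AlgebraicGeometry CategoryTheory CategoryTheory.Limits

universe u
open Algebra

theorem aux_ringKrullDim_integral (A D : Type u) [CommRing A] [CommRing D] [Algebra A D]
    [FaithfulSMul A D] [Algebra.IsIntegral A D] : ringKrullDim D = ringKrullDim A := by
  apply le_antisymm
  · refine Order.krullDim_le_of_strictMono (PrimeSpectrum.comap (algebraMap A D)) ?_
    intro I J h
    exact Ideal.IsIntegral.comap_lt_comap (R := A) (A := D) h
  · refine iSup_le fun l => ?_
    obtain ⟨Q, hQ⟩ : ∃ Q, PrimeSpectrum.comap (algebraMap A D) Q = l.head := 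
      Algebra.IsIntegral.comap_surjective _ _ l.head
    have : Q.asIdeal.LiesOver l.head.asIdeal := ⟨by rw [← hQ]; rfl⟩
    obtain ⟨L, hL, -⟩ := Ideal.exists_ltSeries_of_hasGoingUp l Q.asIdeal
    rw [← hL]
    exact Order.LTSeries.length_le_krullDim L

theorem aux_trdeg_of_algebraic (k A D : Type u) [CommRing k] [CommRing A] [CommRing D]
    [Nontrivial k] [IsDomain D]
    [Algebra k A] [Algebra A D] [Algebra k D] [IsScalarTower k A D] [FaithfulSMul k A]
    [FaithfulSMul A D] [Algebra.IsAlgebraic A D] : Algebra.trdeg k D = Algebra.trdeg k A := by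
  have := (FaithfulSMul.algebraMap_injective A D).isDomain _
  rw [← trdeg_add_eq k A (A := D), trdeg_eq_zero (R := A) (A := D), add_zero]

theorem aux_dim_field (k D : Type u) [Field k] [CommRing D] [IsDomain D] [Algebra k D]
    [Algebra.FiniteType k D] (n : ℕ) (h : Algebra.trdeg k D = n) :
    ringKrullDim D = n := by
  obtain ⟨s, g, hg, hi⟩ := exists_integral_inj_algHom_of_fg k D
  algebraize [g.toRingHom]
  have : Algebra.IsIntegral (MvPolynomial (Fin s) k) D := ⟨hi⟩
  have : FaithfulSMul (MvPolynomial (Fin s) k) D := 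
    (faithfulSMul_iff_algebraMap_injective _ _).2 hg
  rw [aux_ringKrullDim_integral (MvPolynomial (Fin s) k) D,
    MvPolynomial.ringKrullDim_of_isNoetherianRing]
  rw [aux_trdeg_of_algebraic k (MvPolynomial (Fin s) k) D, MvPolynomial.trdeg_of_isDomain] at h
  have : s = n := by simpa using h
  simp [this, ringKrullDim_eq_zero_of_field]
open Algebra
theorem aux_dim_range {Y Z : Type*} [TopologicalSpace Y] [TopologicalSpace Z] {φ : Y → Z}
    (h : Topology.IsEmbedding φ) (S : Set Z) (hS : Set.range φ = S) :
    topologicalKrullDim S = topologicalKrullDim Y := by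
  subst hS
  exact (h.toHomeomorph.isHomeomorph.topologicalKrullDim_eq).symm

theorem aux_dim_generic (R C : Type u) [CommRing R] [CommRing C] [IsDomain R] [IsDomain C]
    [Algebra R C] [FaithfulSMul R C] [Algebra.FiniteType R C] (n : ℕ)
    (h : Algebra.trdeg R C = n) :
    topologicalKrullDim ↥{Q : PrimeSpectrum C | Q.asIdeal.comap (algebraMap R C) = ⊥} = n := by
  let M := Algebra.algebraMapSubmonoid C (nonZeroDivisors R)
  have hM : M ≤ nonZeroDivisors C := by
    rintro _ ⟨r, hr, rfl⟩
    simpa using hr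
  let K := FractionRing R
  let D := Localization M
  have : IsDomain D := IsLocalization.isDomain_localization hM
  let _ : Algebra K D := localizationAlgebra (nonZeroDivisors R) C
  have : IsScalarTower R K D := 
    .of_algebraMap_eq (fun x => (IsLocalization.map_eq (M := nonZeroDivisors R) (T := M) (S := K) (Q := D) (g := algebraMap R C) _ x).symm)
  have : Algebra.FiniteType K D := by
    have : IsLocalization ((nonZeroDivisors R).map (algebraMap R C)) D := inferInstanceAs (IsLocalization M (Localization M))
    have := RingHom.finiteType_localizationPreserves (algebraMap R C) (nonZeroDivisors R) K D
      (RingHom.finiteType_algebraMap.2 inferInstance)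
    exact RingHom.finiteType_algebraMap.1 this
  have : FaithfulSMul C D := (faithfulSMul_iff_algebraMap_injective _ _).2 (IsLocalization.injective D hM)
  have : Algebra.IsAlgebraic C D := IsLocalization.isAlgebraic D M
  have : FaithfulSMul R D := FaithfulSMul.trans R C D
  have : FaithfulSMul K D := (faithfulSMul_iff_algebraMap_injective _ _).2 (algebraMap K D).injective
  have : Algebra.IsAlgebraic R K := IsLocalization.isAlgebraic K (nonZeroDivisors R)
  have hKD : Algebra.trdeg K D = n := by
    rw [← h, ← aux_trdeg_of_algebraic R C D, ← trdeg_add_eq R K (A := D), trdeg_eq_zero (R := R) (A := K), zero_add]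
  rw [← aux_dim_field K D n hKD, ← PrimeSpectrum.topologicalKrullDim_eq_ringKrullDim]
  refine aux_dim_range (PrimeSpectrum.localization_comap_isEmbedding D M) _ ?_
  rw [PrimeSpectrum.localization_comap_range D M]
  ext Q
  simp only [Set.mem_ofPred_eq, Set.disjoint_left]
  constructor
  · intro H
    rw [eq_bot_iff]
    intro r hr
    by_contra h0
    exact H ⟨r, by simpa using h0, rfl⟩ hr
  · rintro H _ ⟨r, hr, rfl⟩ h0
    have : r ∈ Q.asIdeal.comap (algebraMap R C) := h0
    rw [H] at this
    simp_all

theorem aux_dim_generic_away (R C : Type u) [CommRing R] [CommRing C] [IsDomain R] [IsDomain C]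
    [Algebra R C] [FaithfulSMul R C] [Algebra.FiniteType R C] (n : ℕ)
    (h : Algebra.trdeg R C = n) (g : C) (hg : g ≠ 0) :
    topologicalKrullDim ↥{Q : PrimeSpectrum C | Q.asIdeal.comap (algebraMap R C) = ⊥ ∧
      g ∉ Q.asIdeal} = n := by
  let E := Localization.Away g
  have hM : Submonoid.powers g ≤ nonZeroDivisors C := powers_le_nonZeroDivisors_of_noZeroDivisors hg
  have : IsDomain E := IsLocalization.isDomain_localization hM
  have : FaithfulSMul C E := (faithfulSMul_iff_algebraMap_injective _ _).2 (IsLocalization.injective E hM)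
  have : FaithfulSMul R E := FaithfulSMul.trans R C E
  have : Algebra.IsAlgebraic C E := IsLocalization.isAlgebraic E (Submonoid.powers g)
  have : Algebra.FiniteType C E := IsLocalization.finiteType_of_monoid_fg (Submonoid.powers g) E
  have : Algebra.FiniteType R E := Algebra.FiniteType.trans (S := C) inferInstance inferInstance
  have hE := aux_dim_generic R E n (by rw [← h, ← aux_trdeg_of_algebraic R C E])
  rw [← hE]
  refine aux_dim_range (φ := PrimeSpectrum.comap (algebraMap C E) ∘ Subtype.val)
    ((PrimeSpectrum.localization_comap_isEmbedding E (Submonoid.powers g)).comp Topology.IsEmbedding.subtypeVal) _ ?_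
  ext Q
  have hr := PrimeSpectrum.localization_comap_range E (Submonoid.powers g)
  constructor
  · rintro ⟨⟨Q', h'⟩, rfl⟩
    refine ⟨?_, ?_⟩
    · refine Eq.trans ?_ h'
      show Ideal.comap (algebraMap R C) (Ideal.comap (algebraMap C E) Q'.asIdeal) = Q'.asIdeal.comap (algebraMap R E)
      rw [IsScalarTower.algebraMap_eq R C E, ← Ideal.comap_comap]
    · have : PrimeSpectrum.comap (algebraMap C E) Q' ∈ Set.range (PrimeSpectrum.comap (algebraMap C E)) := ⟨_, rfl⟩
      rw [hr] at this
      exact Set.disjoint_left.1 this (Submonoid.mem_powers g)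
  · rintro ⟨h1, h2⟩
    have : Q ∈ Set.range (PrimeSpectrum.comap (algebraMap C E)) := by
      rw [hr]
      exact (Ideal.disjoint_powers_iff_notMem g Q.2.isRadical).2 h2
    obtain ⟨Q', rfl⟩ := this
    refine ⟨⟨Q', ?_⟩, rfl⟩
    show Q'.asIdeal.comap _ = ⊥
    rw [← h1, IsScalarTower.algebraMap_eq R C E, ← Ideal.comap_comap]; rfl

theorem aux_dim_fiber (R C : Type u) [CommRing R] [CommRing C]
    [Algebra R C] [Algebra.FiniteType R C] (P : Ideal C) [P.IsPrime] (n : ℕ)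
    (h : Algebra.trdeg (R ⧸ P.under R) (C ⧸ P) = n) (g : C) (hg : g ∉ P) :
    topologicalKrullDim ↥{Q : PrimeSpectrum C | P ≤ Q.asIdeal ∧ 
      Q.asIdeal.comap (algebraMap R C) = P.comap (algebraMap R C) ∧ g ∉ Q.asIdeal} = n := by
  have : Algebra.FiniteType (R ⧸ P.under R) (C ⧸ P) :=
    .of_restrictScalars_finiteType R _ _
  rw [← aux_dim_generic_away (R ⧸ P.under R) (C ⧸ P) n h (Ideal.Quotient.mk P g)
    (by rwa [Ne, Ideal.Quotient.eq_zero_iff_mem])]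
  have hs := Ideal.Quotient.mk_surjective (I := P)
  have hr := _root_.range_comap_of_surjective _ _ hs
  have key (Q : PrimeSpectrum (C ⧸ P)) : Q.asIdeal.comap (algebraMap (R ⧸ P.under R) (C ⧸ P)) = ⊥ ↔
     (Q.asIdeal.comap (Ideal.Quotient.mk P)).comap (algebraMap R C) = P.comap (algebraMap R C) := by
    have hc : (Q.asIdeal.comap (Ideal.Quotient.mk P)).comap (algebraMap R C) = 
      (Q.asIdeal.comap (algebraMap (R ⧸ P.under R) (C ⧸ P))).comap (Ideal.Quotient.mk _) := by
        rw [Ideal.comap_comap, Ideal.comap_comap]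
        rfl
    have h2 : P.comap (algebraMap R C) = 
       (⊥ : Ideal (R ⧸ P.under R)).comap (Ideal.Quotient.mk _) := by
      rw [← RingHom.ker_eq_comap_bot, Ideal.mk_ker]
    refine Iff.trans ?_ (Eq.congr hc h2).symm
    exact (Ideal.comap_injective_of_surjective _ Ideal.Quotient.mk_surjective).eq_iff.symm
  refine aux_dim_range (φ := PrimeSpectrum.comap (Ideal.Quotient.mk P) ∘ Subtype.val)
    ((PrimeSpectrum.isClosedEmbedding_comap_of_surjective _ _ hs).isEmbedding.comp .subtypeVal) _ ?_
  ext Q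
  constructor
  · rintro ⟨⟨Q', h1, h2⟩, rfl⟩
    refine ⟨?_, (key _).1 h1, h2⟩
    intro x hx
    show Ideal.Quotient.mk P x ∈ Q'.asIdeal
    rw [Ideal.Quotient.eq_zero_iff_mem.2 hx]; exact zero_mem _
  · rintro ⟨h0, h1, h2⟩
    have : Q ∈ Set.range (PrimeSpectrum.comap (Ideal.Quotient.mk P)) := by
      rw [hr, Ideal.mk_ker]; exact h0
    obtain ⟨Q', rfl⟩ := this
    exact ⟨⟨Q', (key _).2 h1, h2⟩, rfl⟩

theorem aux_quasiFiniteAt (A C : Type u) [CommRing A] [CommRing C] [Algebra A C]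
    [Algebra.FiniteType A C] (P : PrimeSpectrum C) (g : C) (hg : g ∉ P.asIdeal)
    (H : ∀ Q : PrimeSpectrum C, g ∉ Q.asIdeal → 
      Q.asIdeal.comap (algebraMap A C) = P.asIdeal.comap (algebraMap A C) → Q = P) :
    ∃ r : C, r ∉ P.asIdeal ∧ ∀ x, ∃ m, IsIntegral A (r ^ m * x) := by
  have : Algebra.QuasiFiniteAt A P.asIdeal := by
    apply Algebra.QuasiFiniteAt.of_isOpen_singleton_fiber
    rw [isOpen_induced_iff]
    refine ⟨PrimeSpectrum.basicOpen g, (PrimeSpectrum.basicOpen g).2, ?_⟩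
    ext ⟨Q, hQ⟩
    simp only [Set.mem_preimage, SetLike.mem_coe, PrimeSpectrum.mem_basicOpen, Set.mem_singleton_iff]
    constructor
    · intro h
      exact Subtype.ext <| H Q h (congrArg PrimeSpectrum.asIdeal hQ)
    · intro h
      rw [show Q = P from congrArg Subtype.val h]
      exact hg
  obtain ⟨r, h1, h2⟩ := Algebra.zariskisMainProperty_iff'.1 
    (Algebra.ZariskisMainProperty.of_finiteType (R := A) P.asIdeal)
  exact ⟨r, h1, h2⟩

theorem aux_exists_sep (C : Type u) [CommRing C] [IsNoetherianRing C] (I P : Ideal C)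
    (hP : P ∈ I.minimalPrimes) : ∃ g ∉ P, ∀ Q : Ideal C, Q.IsPrime → I ≤ Q → g ∉ Q → P ≤ Q := by
  have hfin := I.finite_minimalPrimes_of_isNoetherianRing C
  have hPp := hP.1.1
  let J : Ideal C := (hfin.toFinset.erase P).inf id
  have hJ : ¬ J ≤ P := by
    intro h
    rw [Ideal.IsPrime.inf_le' hPp] at h
    obtain ⟨N, hN, hNP⟩ := h
    simp only [Finset.mem_erase, Set.Finite.mem_toFinset] at hN
    exact hN.1 (le_antisymm hNP (hP.2 hN.2.1 hNP))
  obtain ⟨g, hgJ, hgP⟩ := SetLike.not_le_iff_exists.1 hJ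
  refine ⟨g, hgP, fun Q hQ hIQ hgQ => ?_⟩
  obtain ⟨N, hN, hNQ⟩ := Ideal.exists_minimalPrimes_le hIQ
  by_cases h : N = P
  · exact h ▸ hNQ
  · exact absurd (hNQ ((Finset.inf_le (f := id) (by simp [h, hN]) : J ≤ N) hgJ)) hgQ

theorem aux_trdeg_special (R C R1 C1 : Type u) [CommRing R] [CommRing C] [CommRing R1] [CommRing C1]
    [IsDomain R] [IsDomain C] [IsDomain R1] [IsDomain C1] [IsNoetherianRing R]
    [Algebra R C] [FaithfulSMul R C] [Algebra.FiniteType R C]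
    [Algebra R1 C1] [FaithfulSMul R1 C1] 
    [Algebra R R1] [Algebra C C1] [Algebra R C1] [IsScalarTower R C C1] [IsScalarTower R R1 C1]
    (hR : Function.Surjective (algebraMap R R1)) (hC : Function.Surjective (algebraMap C C1))
    (hne : RingHom.ker (algebraMap R R1) ≠ ⊥)
    (hht : ∀ p : Ideal R, p.IsPrime → p ≠ ⊥ → p ≤ RingHom.ker (algebraMap R R1) → 
      p = RingHom.ker (algebraMap R R1))
    (hmin : RingHom.ker (algebraMap C C1) ∈ 
      ((RingHom.ker (algebraMap R R1)).map (algebraMap R C)).minimalPrimes) :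
    trdeg R C = trdeg R1 C1 := by
  have : IsNoetherianRing C := Algebra.FiniteType.isNoetherianRing R C
  have : Algebra.FiniteType R C1 := .of_surjective (IsScalarTower.toAlgHom R C C1) hC
  have : Algebra.FiniteType R1 C1 := .of_restrictScalars_finiteType R _ _
  obtain ⟨ι, y, hy⟩ : ∃ (ι : Type u) (y : ι → C1), IsTranscendenceBasis R1 y := by
    obtain ⟨s, hs⟩ := exists_isTranscendenceBasis R1 C1
    exact ⟨s, _, hs⟩
  have hcard : Cardinal.mk ι = trdeg R1 C1 := hy.cardinalMk_eq_trdeg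
  have : Finite ι := by
    rw [← Cardinal.lt_aleph0_iff_finite, hcard]
    exact trdeg_lt_aleph0_of_finiteType
  choose Y hY using fun i => hC (y i)
  let A := MvPolynomial ι R
  let _ : Algebra A C := (MvPolynomial.aeval Y).toAlgebra
  have : IsScalarTower R A C := .of_algebraMap_eq' (MvPolynomial.aeval Y).comp_algebraMap.symm
  have hAC (F : A) : algebraMap A C F = MvPolynomial.aeval Y F := rfl
  have hcomm (F : A) : algebraMap C C1 (algebraMap A C F) = 
      MvPolynomial.aeval y (MvPolynomial.map (algebraMap R R1) F) := by
    rw [hAC, MvPolynomial.aeval_map_algebraMap]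
    rw [← MvPolynomial.aeval_algebraMap_apply]
    congr 2
    exact funext hY
  have hyinj : Function.Injective (MvPolynomial.aeval (R := R1) y) := hy.1
  set p := RingHom.ker (algebraMap R R1) with hp
  have hpprime : p.IsPrime := RingHom.ker_isPrime _
  obtain ⟨t, htp, ht0⟩ := Submodule.exists_mem_ne_zero_of_ne_bot hne
  -- the extended ideal
  let M : Ideal A := RingHom.ker (MvPolynomial.map (σ := ι) (algebraMap R R1))
  have hMC : M = p.map MvPolynomial.C := MvPolynomial.ker_map _
  have hMprime : M.IsPrime := RingHom.ker_isPrime _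
  have hMht : M.height ≤ 1 := by
    refine Ideal.height_le_one_of_isPrincipal_of_mem_minimalPrimes 
      (Ideal.span {(MvPolynomial.C t : A)}) M ⟨⟨hMprime, ?_⟩, ?_⟩
    · rw [Ideal.span_singleton_le_iff_mem, hMC]
      exact Ideal.mem_map_of_mem _ htp
    · rintro N ⟨hN, htN⟩ hNM
      rw [Ideal.span_singleton_le_iff_mem] at htN
      have := hht (N.comap MvPolynomial.C) inferInstance (fun h0 => ht0 (by
        have : t ∈ N.comap (MvPolynomial.C (σ := ι)) := htN
        rwa [h0] at this)) (fun r hr => by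
          have : MvPolynomial.C r ∈ M := hNM hr
          rw [RingHom.mem_ker, MvPolynomial.map_C] at this
          exact MvPolynomial.C_injective ι _ (this.trans (map_zero _).symm))
      rw [hMC, Ideal.map_le_iff_le_comap, this]
  have hinj : Function.Injective (algebraMap A C) := by
    rw [RingHom.injective_iff_ker_eq_bot]
    by_contra hQ
    have hQp : (RingHom.ker (algebraMap A C)).IsPrime := RingHom.ker_isPrime _
    have hlt : RingHom.ker (algebraMap A C) < M := by
      refine lt_of_le_of_ne ?_ ?_
      · intro F hF
        have := hcomm F
        rw [RingHom.mem_ker.1 hF, map_zero] at this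
        exact hyinj (by rw [← this, map_zero])
      · intro h
        have : (MvPolynomial.C t : A) ∈ M := by
          rw [hMC]; exact Ideal.mem_map_of_mem _ htp
        rw [← h, RingHom.mem_ker, hAC, MvPolynomial.aeval_C] at this
        exact ht0 (FaithfulSMul.algebraMap_injective R C (by simpa using this))
    have h1 := Ideal.height_le_iff.1 hMht _ hQp hlt
    have h2 : (RingHom.ker (algebraMap A C)).height ≤ 0 := Order.lt_one_iff_nonpos.1 h1
    have h3 := Ideal.height_le_iff.1 h2 ⊥ Ideal.isPrime_bot (bot_lt_iff_ne_bot.2 hQ)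
    simp at h3
  have : FaithfulSMul A C := (faithfulSMul_iff_algebraMap_injective _ _).2 hinj
  have : Algebra.FiniteType A C := .of_restrictScalars_finiteType R _ _
  set P := RingHom.ker (algebraMap C C1) with hP
  have hPp : P.IsPrime := RingHom.ker_isPrime _
  obtain ⟨g, hgP, hg⟩ := aux_exists_sep C _ P hmin
  obtain ⟨r, hrP, hr⟩ := aux_quasiFiniteAt A C ⟨P, hPp⟩ g hgP (by
    intro Q hgQ hQP
    have hQR : p.map (algebraMap R C) ≤ Q.asIdeal := by
      rw [Ideal.map_le_iff_le_comap]
      intro r hr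
      have h1 : algebraMap R C r ∈ P := hmin.1.2 (Ideal.mem_map_of_mem _ hr)
      have h2 : (algebraMap R A r) ∈ P.comap (algebraMap A C) := by
        rw [Ideal.mem_comap, ← IsScalarTower.algebraMap_apply]; exact h1
      change _ = P.comap (algebraMap A C) at hQP
      rw [← hQP, Ideal.mem_comap, ← IsScalarTower.algebraMap_apply] at h2
      exact h2
    have hPQ := hg Q.asIdeal Q.2 hQR hgQ
    ext1
    refine le_antisymm ?_ hPQ
    intro c hc
    by_contra hcP
    have hc1 : algebraMap C C1 c ≠ 0 := hcP
    have halg := hy.isAlgebraic.isAlgebraic (algebraMap C C1 c)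
    have := Ideal.comap_ne_bot_of_algebraic_mem (I := Q.asIdeal.map (algebraMap C C1)) hc1
      (Ideal.mem_map_of_mem _ hc) halg
    obtain ⟨⟨s, hs⟩, hsQ, hs0⟩ := Submodule.exists_mem_ne_zero_of_ne_bot this
    rw [Algebra.adjoin_range_eq_range_aeval] at hs
    obtain ⟨F1, rfl⟩ := hs
    obtain ⟨F, rfl⟩ := MvPolynomial.map_surjective _ hR F1
    have hsQ' : algebraMap C C1 (algebraMap A C F) ∈ Q.asIdeal.map (algebraMap C C1) := by
      rw [hcomm]; exact hsQ
    have hF : algebraMap A C F ∈ Q.asIdeal := by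
      have := Ideal.comap_map_of_surjective' (algebraMap C C1) hC Q.asIdeal
      have h3 : algebraMap A C F ∈ (Q.asIdeal.map (algebraMap C C1)).comap (algebraMap C C1) := hsQ'
      rw [this] at h3
      exact (sup_le le_rfl hPQ) h3
    have hFP : F ∈ P.comap (algebraMap A C) := by
      change _ = P.comap (algebraMap A C) at hQP
      rw [← hQP]; exact hF
    have hF0 : algebraMap C C1 (algebraMap A C F) = 0 := hFP
    rw [hcomm] at hF0
    exact hs0 (Subtype.ext hF0))
  have hr0 : r ≠ 0 := fun h => hrP (h ▸ zero_mem _)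
  have : Algebra.IsAlgebraic A C := by
    have hx0 (x : C) : ∃ m, IsAlgebraic A (r ^ m * x) := (hr x).imp fun m h => h.isAlgebraic
    refine ⟨fun x => ?_⟩
    obtain ⟨m, hm⟩ := hx0 x
    obtain ⟨k, hk⟩ := hx0 r
    rw [← pow_succ] at hk
    have hr1 : IsAlgebraic A r := IsAlgebraic.of_pow (Nat.succ_pos k) hk
    exact IsAlgebraic.of_mul (mem_nonZeroDivisors_of_ne_zero (pow_ne_zero m hr0)) (hr1.pow m) hm
  rw [aux_trdeg_of_algebraic R A C, MvPolynomial.trdeg_of_isDomain, Cardinal.lift_id, hcard]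
open Algebra in

theorem aux_trdeg_pair (R C : Type u) [CommRing R] [CommRing C] [IsNoetherianRing R]
    [Algebra R C] [Algebra.FiniteType R C] (ξ x : Ideal C) [ξ.IsPrime] [x.IsPrime]
    (hle : ξ ≤ x) (hne : ξ.under R ≠ x.under R)
    (hbet : ∀ p : Ideal R, p.IsPrime → ξ.under R ≤ p → p ≤ x.under R → 
      p = ξ.under R ∨ p = x.under R)
    (hmin : ∀ Q : Ideal C, Q.IsPrime → Q ≤ x → Q.under R = x.under R → Q = x) :
    trdeg (R ⧸ ξ.under R) (C ⧸ ξ) = trdeg (R ⧸ x.under R) (C ⧸ x) := by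
  have hle' : ξ.under R ≤ x.under R := Ideal.comap_mono hle
  let fR := Ideal.Quotient.factor hle'
  let fC := Ideal.Quotient.factor hle
  have hfR : Function.Surjective fR := Ideal.Quotient.factor_surjective hle'
  have hfC : Function.Surjective fC := Ideal.Quotient.factor_surjective hle
  letI : Algebra (R ⧸ ξ.under R) (R ⧸ x.under R) := fR.toAlgebra
  letI : Algebra (C ⧸ ξ) (C ⧸ x) := fC.toAlgebra
  letI : Algebra (R ⧸ ξ.under R) (C ⧸ x) := (fC.comp (algebraMap (R ⧸ ξ.under R) (C ⧸ ξ))).toAlgebra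
  haveI : IsScalarTower (R ⧸ ξ.under R) (C ⧸ ξ) (C ⧸ x) := .of_algebraMap_eq' rfl
  haveI : IsScalarTower (R ⧸ ξ.under R) (R ⧸ x.under R) (C ⧸ x) := by
    apply IsScalarTower.of_algebraMap_eq'
    apply Ideal.Quotient.ringHom_ext
    ext r
    rfl
  have hker : RingHom.ker (algebraMap (R ⧸ ξ.under R) (R ⧸ x.under R)) = 
      (x.under R).map (Ideal.Quotient.mk (ξ.under R)) := Ideal.Quotient.factor_ker hle'
  have hkerC : RingHom.ker (algebraMap (C ⧸ ξ) (C ⧸ x)) = 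
      x.map (Ideal.Quotient.mk ξ) := Ideal.Quotient.factor_ker hle
  have hmemR : ∀ r : R, Ideal.Quotient.mk (ξ.under R) r ∈ 
      RingHom.ker (algebraMap (R ⧸ ξ.under R) (R ⧸ x.under R)) ↔ r ∈ x.under R := by
    intro r
    rw [RingHom.mem_ker]
    exact Ideal.Quotient.eq_zero_iff_mem
  have hmemC : ∀ r : C, Ideal.Quotient.mk ξ r ∈ 
      RingHom.ker (algebraMap (C ⧸ ξ) (C ⧸ x)) ↔ r ∈ x := by
    intro r
    rw [RingHom.mem_ker]
    exact Ideal.Quotient.eq_zero_iff_mem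
  have hpr : (RingHom.ker (algebraMap (C ⧸ ξ) (C ⧸ x))).IsPrime := RingHom.ker_isPrime _
  haveI : Algebra.FiniteType R (C ⧸ ξ) := .of_surjective (IsScalarTower.toAlgHom R C (C ⧸ ξ)) 
    Ideal.Quotient.mk_surjective
  haveI : Algebra.FiniteType (R ⧸ ξ.under R) (C ⧸ ξ) := .of_restrictScalars_finiteType R _ _
  apply aux_trdeg_special (R ⧸ ξ.under R) (C ⧸ ξ) (R ⧸ x.under R) (C ⧸ x) hfR hfC
  · intro h
    apply hne
    apply le_antisymm hle'
    intro r hr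
    rw [← hmemR, h, Ideal.mem_bot] at hr
    exact Ideal.Quotient.eq_zero_iff_mem.1 hr
  · intro p hp hp0 hpk
    have h1 : ξ.under R ≤ p.comap (Ideal.Quotient.mk _) := by
      intro r hr
      rw [Ideal.mem_comap, Ideal.Quotient.eq_zero_iff_mem.2 hr]
      exact zero_mem _
    have h2 : p.comap (Ideal.Quotient.mk _) ≤ x.under R := by
      intro r hr
      exact (hmemR r).1 (hpk hr)
    rcases hbet _ (hp.comap _) h1 h2 with h | h
    · exfalso
      apply hp0
      rw [eq_bot_iff]
      intro a ha
      obtain ⟨r, rfl⟩ := Ideal.Quotient.mk_surjective a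
      rw [Ideal.mem_bot, Ideal.Quotient.eq_zero_iff_mem, ← h]
      exact ha
    · apply le_antisymm hpk
      intro a ha
      obtain ⟨r, rfl⟩ := Ideal.Quotient.mk_surjective a
      rw [hmemR, ← h] at ha
      exact ha
  · refine ⟨⟨hpr, ?_⟩, ?_⟩
    · rw [Ideal.map_le_iff_le_comap]
      intro a ha
      obtain ⟨r, rfl⟩ := Ideal.Quotient.mk_surjective a
      rw [hmemR] at ha
      exact (hmemC (algebraMap R C r)).2 ha
    · rintro Q ⟨hQ, hQ1⟩ hQ2
      have h2 : Q.comap (Ideal.Quotient.mk ξ) ≤ x := by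
        intro r hr
        exact (hmemC r).1 (hQ2 hr)
      have h3 : (Q.comap (Ideal.Quotient.mk ξ)).under R = x.under R := by
        apply le_antisymm (Ideal.comap_mono h2)
        intro r hr
        have := hQ1 (Ideal.mem_map_of_mem _ ((hmemR r).2 hr))
        exact this
      have h4 := hmin _ (hQ.comap _) h2 h3
      intro a ha
      obtain ⟨r, rfl⟩ := Ideal.Quotient.mk_surjective a
      rw [hmemC, ← h4] at ha
      exact ha

open TopologicalSpace in
theorem aux_dim_local {T : Type*} [TopologicalSpace T] (n : ℕ)
    (h : ∀ t : T, ∃ O : Set T, IsOpen O ∧ t ∈ O ∧ topologicalKrullDim O ≤ n) :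
    topologicalKrullDim T ≤ n := by
  refine iSup_le fun s => ?_
  obtain ⟨t, ht⟩ := s.head.isIrreducible.nonempty
  obtain ⟨O, hO, htO, hd⟩ := h t
  have ho : Topology.IsOpenEmbedding (Subtype.val : O → T) := hO.isOpenEmbedding_subtypeVal
  let e := IrreducibleCloseds.orderIsoOfIsOpenEmbedding (Subtype.val : O → T) ho
  have hmem : ∀ i, s i ∈ {V : IrreducibleCloseds T | ((Subtype.val : O → T) ⁻¹' V).Nonempty} := by
    intro i
    refine ⟨⟨t, htO⟩, ?_⟩
    exact (s.head_le i : s.head ≤ s i) ht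
  let s' : LTSeries (IrreducibleCloseds O) := 
    { length := s.length
      toFun := fun i => e.symm ⟨s i, hmem i⟩
      step := fun i => e.symm.strictMono (s.step i) }
  exact (Order.LTSeries.length_le_krullDim s').trans hd

theorem aux_spec_iff {X : Scheme.{u}} {W : X.Opens} (hW : IsAffineOpen W)
    (P Q : PrimeSpectrum Γ(X, W)) :
    (hW.fromSpec P ⤳ hW.fromSpec Q) ↔ P.asIdeal ≤ Q.asIdeal := by
  have h : Topology.IsInducing hW.fromSpec := hW.fromSpec.isOpenEmbedding.isInducing
  exact h.specializes_iff.trans (PrimeSpectrum.le_iff_specializes P Q).symm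

theorem aux_map_fromSpec {X B : Scheme.{u}} (f : X ⟶ B) {V : B.Opens} (hV : IsAffineOpen V)
    {W : X.Opens} (hW : IsAffineOpen W) (e : W ≤ f ⁻¹ᵁ V) (P : PrimeSpectrum Γ(X, W)) :
    f (hW.fromSpec P) = hV.fromSpec (PrimeSpectrum.comap (f.appLE V W e).hom P) := by
  have h := hV.SpecMap_appLE_fromSpec f hW e
  have h2 := congrArg (fun k => k.base P) h
  exact h2.symm

theorem aux_fib_iff {X B : Scheme.{u}} (f : X ⟶ B) {V : B.Opens} (hV : IsAffineOpen V)
    {W : X.Opens} (hW : IsAffineOpen W) (e : W ≤ f ⁻¹ᵁ V) (P Q : PrimeSpectrum Γ(X, W)) :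
    f (hW.fromSpec P) = f (hW.fromSpec Q) ↔ 
      P.asIdeal.comap (f.appLE V W e).hom = Q.asIdeal.comap (f.appLE V W e).hom := by
  rw [aux_map_fromSpec f hV hW e, aux_map_fromSpec f hV hW e]
  have hinj : Function.Injective hV.fromSpec := hV.fromSpec.isOpenEmbedding.injective
  exact hinj.eq_iff.trans PrimeSpectrum.ext_iff

theorem aux_exists_prime {X : Scheme.{u}} {W : X.Opens} (hW : IsAffineOpen W) (x : X) (hx : x ∈ W) :
    ∃ P : PrimeSpectrum Γ(X, W), hW.fromSpec P = x :=
  ⟨_, hW.fromSpec_primeIdealOf ⟨x, hx⟩⟩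

theorem aux_mem_basicOpen {X : Scheme.{u}} {W : X.Opens} (hW : IsAffineOpen W) 
    (P : PrimeSpectrum Γ(X, W)) (g : Γ(X, W)) :
    hW.fromSpec P ∈ X.basicOpen g ↔ g ∉ P.asIdeal := by
  have h := hW.fromSpec_preimage_basicOpen g
  have h2 : P ∈ hW.fromSpec ⁻¹ᵁ X.basicOpen g ↔ P ∈ PrimeSpectrum.basicOpen g := by rw [h]; rfl
  exact h2

theorem aux_dim_affine {X B : Scheme.{u}} (f : X ⟶ B) [LocallyOfFiniteType f]
    {V : B.Opens} (hV : IsAffineOpen V)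
    {W : X.Opens} (hW : IsAffineOpen W) (e : W ≤ f ⁻¹ᵁ V) [Algebra Γ(B, V) Γ(X, W)]
    (halg : algebraMap Γ(B, V) Γ(X, W) = (f.appLE V W e).hom)
    (P : PrimeSpectrum Γ(X, W)) (n : ℕ)
    (hn : trdeg (Γ(B, V) ⧸ P.asIdeal.under Γ(B, V)) (Γ(X, W) ⧸ P.asIdeal) = n) 
    (g : Γ(X, W)) (hg : hW.fromSpec P ∈ X.basicOpen g) :
    topologicalKrullDim ↥{y : X | hW.fromSpec P ⤳ y ∧ f y = f (hW.fromSpec P) ∧ 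
      y ∈ X.basicOpen g} = n := by
  have hft : Algebra.FiniteType Γ(B, V) Γ(X, W) := by
    rw [← RingHom.finiteType_algebraMap, halg]
    exact f.finiteType_appLE hV hW e
  rw [aux_mem_basicOpen] at hg
  rw [← aux_dim_fiber Γ(B, V) Γ(X, W) P.asIdeal n hn g hg]
  have hemb : Topology.IsEmbedding hW.fromSpec := hW.fromSpec.isOpenEmbedding.isEmbedding
  refine aux_dim_range (φ := (hW.fromSpec : PrimeSpectrum Γ(X, W) → X) ∘ Subtype.val) 
    (hemb.comp .subtypeVal) _ ?_
  ext y
  constructor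
  · rintro ⟨⟨Q, h1, h2, h3⟩, rfl⟩
    refine ⟨(aux_spec_iff hW _ _).2 h1, (aux_fib_iff f hV hW e _ _).2 ?_, 
      (aux_mem_basicOpen hW _ _).2 h3⟩
    rw [← halg]
    exact h2
  · rintro ⟨h1, h2, h3⟩
    obtain ⟨Q, rfl⟩ := aux_exists_prime hW y (X.basicOpen_le g h3)
    refine ⟨⟨Q, (aux_spec_iff hW _ _).1 h1, ?_, (aux_mem_basicOpen hW _ _).1 h3⟩, rfl⟩
    rw [halg]
    exact (aux_fib_iff f hV hW e _ _).1 h2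

theorem aux_trdeg_nat {X B : Scheme.{u}} (f : X ⟶ B) [LocallyOfFiniteType f]
    {V : B.Opens} (hV : IsAffineOpen V)
    {W : X.Opens} (hW : IsAffineOpen W) (e : W ≤ f ⁻¹ᵁ V) [Algebra Γ(B, V) Γ(X, W)]
    (halg : algebraMap Γ(B, V) Γ(X, W) = (f.appLE V W e).hom)
    (P : PrimeSpectrum Γ(X, W)) :
    ∃ n : ℕ, trdeg (Γ(B, V) ⧸ P.asIdeal.under Γ(B, V)) (Γ(X, W) ⧸ P.asIdeal) = n := by
  have hft : Algebra.FiniteType Γ(B, V) Γ(X, W) := by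
    rw [← RingHom.finiteType_algebraMap, halg]
    exact f.finiteType_appLE hV hW e
  have : Algebra.FiniteType Γ(B, V) (Γ(X, W) ⧸ P.asIdeal) := 
    .of_surjective (IsScalarTower.toAlgHom Γ(B, V) Γ(X, W) (Γ(X, W) ⧸ P.asIdeal)) 
    Ideal.Quotient.mk_surjective
  have : Algebra.FiniteType (Γ(B, V) ⧸ P.asIdeal.under Γ(B, V)) (Γ(X, W) ⧸ P.asIdeal) := 
    .of_restrictScalars_finiteType Γ(B, V) _ _
  exact Cardinal.lt_aleph0.1 trdeg_lt_aleph0_of_finiteType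

theorem aux_dim_inter {X : Type*} [TopologicalSpace X] (S T : Set X) (h : S ⊆ T) : 
    topologicalKrullDim S ≤ topologicalKrullDim T :=
  (Topology.IsEmbedding.inclusion h).isInducing.topologicalKrullDim_le

theorem aux_dim_global {X B : Scheme.{u}} (f : X ⟶ B) [LocallyOfFiniteType f]
    {V : B.Opens} (hV : IsAffineOpen V)
    {W : X.Opens} (hW : IsAffineOpen W) (e : W ≤ f ⁻¹ᵁ V) [Algebra Γ(B, V) Γ(X, W)]
    (halg : algebraMap Γ(B, V) Γ(X, W) = (f.appLE V W e).hom)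
    (P : PrimeSpectrum Γ(X, W)) (n : ℕ)
    (hn : trdeg (Γ(B, V) ⧸ P.asIdeal.under Γ(B, V)) (Γ(X, W) ⧸ P.asIdeal) = n) :
    topologicalKrullDim ↥{y : X | hW.fromSpec P ⤳ y ∧ f y = f (hW.fromSpec P)} = n := by
  have hPW : hW.fromSpec P ∈ W := by
    have : hW.fromSpec P ∈ Set.range hW.fromSpec := ⟨P, rfl⟩
    rw [hW.range_fromSpec] at this
    exact this
  have hW1 : X.basicOpen (1 : Γ(X, W)) = W := by simp
  have key := aux_dim_affine f hV hW e halg P n hn 1 (by rw [hW1]; exact hPW)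
  rw [hW1] at key
  apply le_antisymm
  · apply aux_dim_local
    rintro ⟨y, hy1, hy2⟩
    have hyV : y ∈ f ⁻¹ᵁ V := by
      change f y ∈ V
      rw [hy2]
      exact e hPW
    obtain ⟨W', hW', hyW', e'⟩ := exists_isAffineOpen_mem_and_subset hyV
    have hPW' : hW.fromSpec P ∈ W' := hy1.mem_open W'.isOpen hyW'
    obtain ⟨P', hP'⟩ := aux_exists_prime hW' _ hPW'
    let _ : Algebra Γ(B, V) Γ(X, W') := (f.appLE V W' e').hom.toAlgebra
    obtain ⟨n', hn'⟩ := aux_trdeg_nat f hV hW' e' rfl P'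
    have hW1' : X.basicOpen (1 : Γ(X, W')) = W' := by simp
    have key' := aux_dim_affine f hV hW' e' rfl P' n' hn' 1 (by rw [hW1', hP']; exact hPW')
    obtain ⟨g, hg1, hg2⟩ := hW'.exists_basicOpen_le ⟨hW.fromSpec P, hPW⟩ hPW'
    have key2 := aux_dim_affine f hV hW' e' rfl P' n' hn' g (by rw [hP']; exact hg2)
    rw [hP'] at key2 key'
    rw [hW1'] at key'
    have hnn : (n' : WithBot ℕ∞) ≤ n := by
      rw [← key2, ← key]
      apply aux_dim_inter
      rintro t ⟨h1, h2, h3⟩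
      exact ⟨h1, h2, hg1 h3⟩
    refine ⟨Subtype.val ⁻¹' (W' : Set X), W'.isOpen.preimage continuous_subtype_val, hyW', ?_⟩
    refine le_trans ?_ hnn
    rw [← key']
    rw [← aux_dim_range (Topology.IsEmbedding.subtypeVal.comp Topology.IsEmbedding.subtypeVal) _ rfl]
    apply aux_dim_inter
    rintro _ ⟨⟨⟨t, h1, h2⟩, h3⟩, rfl⟩
    exact ⟨h1, h2, h3⟩
  · rw [← key]
    apply aux_dim_inter
    rintro t ⟨h1, h2, h3⟩
    exact ⟨h1, h2⟩

open TopologicalSpace in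
theorem aux_no_between (B : Type*) [TopologicalSpace B] [T0Space B] (hdim : topologicalKrullDim B = 1)
    (a b c : B) (hab : a ⤳ b) (hbc : b ⤳ c) : b = a ∨ b = c := by
  by_contra! hcon
  let C : B → IrreducibleCloseds B := fun x => ⟨closure {x}, isIrreducible_singleton.closure, isClosed_closure⟩
  have hlt : ∀ x y : B, x ⤳ y → y ≠ x → C y < C x := by
    intro x y h hne
    refine lt_of_le_of_ne ?_ ?_
    · exact specializes_iff_closure_subset.1 h
    · intro heq
      apply hne
      have : closure {y} = closure {x} := congrArg IrreducibleCloseds.carrier heq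
      exact (inseparable_iff_closure_eq.2 this).eq
  let s : LTSeries (IrreducibleCloseds B) := 
    { length := 2
      toFun := ![C c, C b, C a]
      step := fun i => by
        fin_cases i
        · exact hlt b c hbc hcon.2.symm
        · exact hlt a b hab hcon.1 }
  have h1 := Order.LTSeries.length_le_krullDim s
  have h2 : s.length = 2 := rfl
  rw [h2] at h1
  change _ ≤ topologicalKrullDim B at h1
  rw [hdim] at h1
  exact absurd h1 (by norm_cast)

/-- The dimension of an irreducible component of a fiber, in terms of its generic point. -/
theorem aux_component {X B : Scheme.{u}} (f : X ⟶ B) (z : B) 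
    (T : Set ↥(f.base ⁻¹' {z})) (hT : T ∈ irreducibleComponents ↥(f.base ⁻¹' {z})) :
    ∃ x : X, f x = z ∧ (∀ y : X, y ⤳ x → f y = z → y = x) ∧ 
      topologicalKrullDim T = topologicalKrullDim ↥{y : X | x ⤳ y ∧ f y = f x} := by
  have : QuasiSober ↥(f.base ⁻¹' {z}) := (f.fiberHomeo z).symm.isClosedEmbedding.quasiSober
  have hirr : IsIrreducible T := hT.1
  have hcl : IsClosed T := isClosed_of_mem_irreducibleComponents T hT
  obtain ⟨⟨x, hx⟩, hg⟩ := QuasiSober.sober hirr hcl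
  have hx' : f x = z := hx
  refine ⟨x, hx, ?_, ?_⟩
  · intro y hyx hy
    have h1 : (⟨y, hy⟩ : ↥(f.base ⁻¹' {z})) ⤳ ⟨x, hx⟩ := 
      Topology.IsInducing.subtypeVal.specializes_iff.1 hyx
    have h2 : T ≤ closure {(⟨y, hy⟩ : ↥(f.base ⁻¹' {z}))} := by
      rw [← hg.def]
      exact specializes_iff_closure_subset.1 h1
    have h3 := hT.2 (isIrreducible_singleton.closure : IsIrreducible (closure {(⟨y, hy⟩ : ↥(f.base ⁻¹' {z}))})) h2
    have h4 : (⟨x, hx⟩ : ↥(f.base ⁻¹' {z})) ⤳ ⟨y, hy⟩ := by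
      rw [specializes_iff_mem_closure, hg.def]
      exact h3 (subset_closure rfl)
    have h5 : x ⤳ y := Topology.IsInducing.subtypeVal.specializes_iff.2 h4
    exact (hyx.antisymm h5).eq
  · symm
    refine aux_dim_range (φ := (Subtype.val : ↥(f.base ⁻¹' {z}) → X) ∘ (Subtype.val : T → _)) 
      (Topology.IsEmbedding.subtypeVal.comp Topology.IsEmbedding.subtypeVal) _ ?_
    ext y
    constructor
    · rintro ⟨⟨⟨y, hy⟩, hyT⟩, rfl⟩
      refine ⟨?_, ?_⟩
      · rw [← hg.def, ← specializes_iff_mem_closure] at hyT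
        exact Topology.IsInducing.subtypeVal.specializes_iff.2 hyT
      · rw [hx']
        exact hy
    · rintro ⟨h1, h2⟩
      have hy : y ∈ f.base ⁻¹' {z} := h2.trans hx'
      refine ⟨⟨⟨y, hy⟩, ?_⟩, rfl⟩
      rw [← hg.def, ← specializes_iff_mem_closure]
      exact Topology.IsInducing.subtypeVal.specializes_iff.1 h1

theorem aux_main {B X : Scheme.{u}} [AlgebraicGeometry.IsNoetherian B]
    (hdim : topologicalKrullDim B = 1)
    (f : X ⟶ B) [LocallyOfFiniteType f] (ξ x : X) (h : ξ ⤳ x) (hne : f ξ ≠ f x)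
    (hmax : ∀ y : X, y ⤳ x → f y = f x → y = x) :
    topologicalKrullDim ↥{y : X | x ⤳ y ∧ f y = f x} = 
      topologicalKrullDim ↥{y : X | ξ ⤳ y ∧ f y = f ξ} := by
  obtain ⟨V, hV, hxV, -⟩ := exists_isAffineOpen_mem_and_subset (U := ⊤) (x := f x) trivial
  obtain ⟨W, hW, hxW, e⟩ := exists_isAffineOpen_mem_and_subset (U := f ⁻¹ᵁ V) (x := x) hxV
  have hξW : ξ ∈ W := h.mem_open W.isOpen hxW
  obtain ⟨P, rfl⟩ := aux_exists_prime hW x hxW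
  obtain ⟨Q, rfl⟩ := aux_exists_prime hW ξ hξW
  let _ : Algebra Γ(B, V) Γ(X, W) := (f.appLE V W e).hom.toAlgebra
  have hft : Algebra.FiniteType Γ(B, V) Γ(X, W) := by
    rw [← RingHom.finiteType_algebraMap]
    exact f.finiteType_appLE hV hW e
  have : IsNoetherianRing Γ(B, V) := IsLocallyNoetherian.component_noetherian ⟨V, hV⟩
  obtain ⟨n, hn⟩ := aux_trdeg_nat f hV hW e rfl P
  have hn' : trdeg (Γ(B, V) ⧸ Q.asIdeal.under Γ(B, V)) (Γ(X, W) ⧸ Q.asIdeal) = n := by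
    rw [← hn]
    apply aux_trdeg_pair
    · exact (aux_spec_iff hW _ _).1 h
    · intro heq
      exact hne ((aux_fib_iff f hV hW e _ _).2 heq)
    · intro p hp h1 h2
      have := aux_no_between B hdim (f (hW.fromSpec Q)) (hV.fromSpec (⟨p, hp⟩ : PrimeSpectrum _)) 
        (f (hW.fromSpec P)) 
        (by rw [aux_map_fromSpec f hV hW e]; exact (aux_spec_iff hV _ _).2 h1)
        (by rw [aux_map_fromSpec f hV hW e]; exact (aux_spec_iff hV _ _).2 h2)
      rw [aux_map_fromSpec f hV hW e, aux_map_fromSpec f hV hW e] at this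
      have hinj : Function.Injective hV.fromSpec := hV.fromSpec.isOpenEmbedding.injective
      exact this.imp (fun h => PrimeSpectrum.ext_iff.1 (hinj h)) 
        (fun h => PrimeSpectrum.ext_iff.1 (hinj h))
    · intro p hp h1 h2
      have hinj : Function.Injective hW.fromSpec := hW.fromSpec.isOpenEmbedding.injective
      have := hmax (hW.fromSpec (⟨p, hp⟩ : PrimeSpectrum _)) ((aux_spec_iff hW _ _).2 h1) 
        ((aux_fib_iff f hV hW e _ _).2 h2)
      exact PrimeSpectrum.ext_iff.1 (hinj this)
  rw [aux_dim_global f hV hW e rfl P n hn, aux_dim_global f hV hW e rfl Q n hn']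

/-- Lemma 8.1: let `B` be a noetherian separated scheme of Krull dimension 1, `z ∈ B` a
closed point and `U = B - z`. If `f : X ⟶ B` is of finite type with `X` irreducible,
`f⁻¹(z) ≠ ∅`, `f⁻¹(U)` dense in `X`, and all irreducible components of all nonempty
fibers over `U` have dimension `d`, then every irreducible component of every nonempty
fiber of `f` (in particular the fiber over `z`) has dimension `d`. -/
theorem equidimensional_over_one_dimensional_base
    (B X : Scheme) [AlgebraicGeometry.IsNoetherian B]
    (hsep : IsSeparated (terminal.from B))
    (hdim : topologicalKrullDim B = 1)
    (z : B) (hz : IsClosed ({z} : Set B))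
    (f : X ⟶ B) [LocallyOfFiniteType f] [QuasiCompact f]
    [IrreducibleSpace X]
    (hfz : (f.base ⁻¹' {z}).Nonempty)
    (hdense : Dense (f.base ⁻¹' {z}ᶜ))
    (d : ℕ)
    (hU : ∀ σ : B, σ ≠ z → (f.base ⁻¹' {σ}).Nonempty →
      ∀ T ∈ irreducibleComponents ↥(f.base ⁻¹' {σ}),
        topologicalKrullDim ↥T = d) :
    ∀ σ : B, (f.base ⁻¹' {σ}).Nonempty →
      ∀ T ∈ irreducibleComponents ↥(f.base ⁻¹' {σ}),
        topologicalKrullDim ↥T = d := by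
  intro σ hσ T hT
  by_cases hσz : σ = z
  swap
  · exact hU σ hσz hσ T hT
  subst hσz
  obtain ⟨x, hx, hmax, hdimT⟩ := aux_component f σ T hT
  have hcont : Continuous f.base := f.continuous
  have hgen : ∀ y : X, genericPoint X ⤳ y := fun y => genericPoint_specializes y
  have hη : f (genericPoint X) ≠ σ := by
    obtain ⟨y, hy⟩ := hdense.nonempty
    have := (hgen y).mem_open (hz.isOpen_compl.preimage hcont) hy
    exact this
  rw [hdimT, aux_main hdim f (genericPoint X) x (hgen x) (by rw [hx]; exact hη) 
    (by rw [hx]; exact hmax)]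
  let ξ' : ↥(f.base ⁻¹' {f (genericPoint X)}) := ⟨genericPoint X, rfl⟩
  obtain ⟨T', hT', hξT'⟩ : ∃ T' ∈ irreducibleComponents ↥(f.base ⁻¹' {f (genericPoint X)}), ξ' ∈ T' :=
    ⟨_, irreducibleComponent_mem_irreducibleComponents ξ', mem_irreducibleComponent⟩
  rw [← hU _ hη ⟨genericPoint X, rfl⟩ T' hT']
  obtain ⟨x', hx', hmax', hdimT'⟩ := aux_component f _ T' hT'
  rw [hdimT']
  have := hmax' (genericPoint X) (hgen x') rfl
  rw [this]
end

section
/- Let B be a noetherian separated scheme whose underlying topological space has Krull dimension 1, let z ∈ B be a closed point, and let U = B \ {z}. Let f : X ⟶ B be a morphism of schemes of finite type such that f⁻¹(z) and f⁻¹(U) are nonempty. Let Z_U be a closed subset of the subspace f⁻¹(U) of positive relative codimension over U, i.e., for every σ ∈ U the set Z_U ∩ f⁻¹(σ) contains no irreducible component of the subspace f⁻¹(σ). Let Z be the closure of Z_U in X. Then Z has positive codimension over z: Z ∩ f⁻¹(z) contains no irreducible component of the subspace f⁻¹(z). (Lemma 8.2) -/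
open AlgebraicGeometry CategoryTheory CategoryTheory.Limits

/-- Krull's principal ideal theorem in geometric form. -/
theorem key_chain {B X : Scheme} [IsLocallyNoetherian X] (f : X ⟶ B) (y w x : X)
    (hyw : y ⤳ w) (hwx : w ⤳ x) (hne : y ≠ w) (hf : f w ≠ f x)
    (h1 : ∀ b : B, f y ⤳ b → b ⤳ f x → b = f w ∨ b = f x)
    (h2 : ∀ p : X, p ⤳ x → f p = f x → p = x) : False := by
  have hr := @Scheme.range_fromSpecStalk X x
  obtain ⟨y', hy'⟩ : y ∈ Set.range (X.fromSpecStalk x) := by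
    rw [hr]; exact hyw.trans hwx
  obtain ⟨w', hw'⟩ : w ∈ Set.range (X.fromSpecStalk x) := by
    rw [hr]; exact hwx
  obtain ⟨x', hx'⟩ : x ∈ Set.range (X.fromSpecStalk x) := by
    rw [hr]; exact specializes_rfl
  have hemb := (X.fromSpecStalk x).isEmbedding
  have hembB := (B.fromSpecStalk (f x)).isEmbedding
  have hcomm : ∀ q, B.fromSpecStalk (f x) (Spec.map (f.stalkMap x) q)
      = f (X.fromSpecStalk x q) := by
    intro q
    rw [← Scheme.Hom.comp_apply, ← Scheme.Hom.comp_apply, Scheme.SpecMap_stalkMap_fromSpecStalk]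
  have hle : ∀ a b : PrimeSpectrum (X.presheaf.stalk x),
      X.fromSpecStalk x a ⤳ X.fromSpecStalk x b → a ≤ b := by
    intro a b h
    exact (PrimeSpectrum.le_iff_specializes a b).2 (hemb.specializes_iff.1 h)
  have hlt1 : @LT.lt (PrimeSpectrum (X.presheaf.stalk x)) _ y' w' := by
    refine lt_of_le_of_ne (hle y' w' ((specializes_of_eq hy').trans (hyw.trans (specializes_of_eq hw'.symm)))) ?_
    rintro rfl
    exact hne (hy'.symm.trans hw')
  have hlt2 : @LT.lt (PrimeSpectrum (X.presheaf.stalk x)) _ w' x' := by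
    refine lt_of_le_of_ne (hle w' x' ((specializes_of_eq hw').trans (hwx.trans (specializes_of_eq hx'.symm)))) ?_
    rintro rfl
    exact hf (by rw [← hw', hx'])
  have hcne : ¬ (PrimeSpectrum.comap (f.stalkMap x).hom x').asIdeal ≤
      (PrimeSpectrum.comap (f.stalkMap x).hom w').asIdeal := by
    intro h
    apply hf
    have e : Spec.map (f.stalkMap x) w' = Spec.map (f.stalkMap x) x' :=
      le_antisymm (α := PrimeSpectrum (B.presheaf.stalk (f x)))
        (Ideal.comap_mono ((PrimeSpectrum.asIdeal_le_asIdeal _ _).2 hlt2.le)) h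
    have := congrArg (B.fromSpecStalk (f x)) e
    rwa [hcomm, hcomm, hw', hx'] at this
  obtain ⟨a, hax, haw⟩ := SetLike.not_le_iff_exists.1 hcne
  obtain ⟨q, hq, hyq, hqx⟩ := PrimeSpectrum.exist_mem_one_of_mem_two hlt1 hlt2
    (x := (f.stalkMap x).hom a) hax
  have hs1 : y ⤳ X.fromSpecStalk x q := by
    rw [← hy']
    exact ((PrimeSpectrum.le_iff_specializes _ _).1 hyq.le).map (X.fromSpecStalk x).continuous
  have hs2 : X.fromSpecStalk x q ⤳ x := by
    conv_rhs => rw [← hx']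
    exact ((PrimeSpectrum.le_iff_specializes _ _).1 hqx.le).map (X.fromSpecStalk x).continuous
  rcases h1 _ (hs1.map f.continuous) (hs2.map f.continuous) with h | h
  · have e := hembB.injective
      ((hcomm q).trans (h.trans ((congrArg f hw').symm.trans (hcomm w').symm)))
    apply haw
    have : a ∈ (Spec.map (f.stalkMap x) q : PrimeSpectrum (B.presheaf.stalk (f x))).asIdeal := hq
    rw [e] at this
    exact this
  · have := h2 _ hs2 h
    exact hqx.ne (hemb.injective (this.trans hx'.symm))

theorem dim_one_between {B : Type*} [TopologicalSpace B] [T0Space B]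
    (hdim : topologicalKrullDim B = 1) (s b z : B) (h1 : s ⤳ b) (h2 : b ⤳ z) :
    b = s ∨ b = z := by
  by_contra! h
  let c : B → TopologicalSpace.IrreducibleCloseds B := fun p =>
    ⟨closure {p}, isIrreducible_singleton.closure, isClosed_closure⟩
  have hc : ∀ p q : B, p ⤳ q → q ≠ p → c q < c p := by
    intro p q h hne
    refine lt_of_le_of_ne (specializes_iff_closure_subset.1 h) ?_
    intro e
    apply hne
    have e' : closure {q} = closure {p} :=
      congrArg TopologicalSpace.IrreducibleCloseds.carrier e
    exact (inseparable_iff_closure_eq.2 e').eq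
  let l : LTSeries (TopologicalSpace.IrreducibleCloseds B) :=
    { length := 2
      toFun := ![c z, c b, c s]
      step := by
        intro i
        fin_cases i
        · exact hc _ _ h2 h.2.symm
        · exact hc _ _ h1 h.1 }
  have hl : l.length = 2 := rfl
  have := Order.LTSeries.length_le_krullDim l
  rw [hl] at this
  rw [topologicalKrullDim] at hdim
  rw [hdim] at this
  exact absurd this (by decide)

theorem fiber_generic {X B : Type*} [TopologicalSpace X] [TopologicalSpace B] [QuasiSober X]
    [T0Space B] (f : X → B) (hf : Continuous f) (s : B) (T : Set ↥(f ⁻¹' {s}))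
    (hT : IsIrreducible T) :
    ∃ x : X, f x = s ∧ IsGenericPoint x (closure (Subtype.val '' T)) := by
  have hi : IsIrreducible (Subtype.val '' T) := hT.image _ continuous_subtype_val.continuousOn
  refine ⟨hi.genericPoint, ?_, hi.isGenericPoint_genericPoint_closure⟩
  have hg := hi.isGenericPoint_genericPoint_closure
  obtain ⟨t, ht⟩ := hT.nonempty
  have a1 : f hi.genericPoint ⤳ s := by
    have := (hg.specializes (subset_closure ⟨t, ht, rfl⟩)).map hf
    rwa [show f t.1 = s from t.2] at this
  have a2 : s ⤳ f hi.genericPoint := by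
    rw [specializes_iff_mem_closure]
    have h3 : closure (Subtype.val '' T) ⊆ f ⁻¹' closure {s} := by
      refine closure_minimal ?_ (isClosed_closure.preimage hf)
      rintro _ ⟨t, -, rfl⟩
      exact subset_closure t.2
    exact h3 hg.mem
  exact (a1.antisymm a2).eq

theorem exists_specializes_of_mem_closure {X : Type*} [TopologicalSpace X] [QuasiSober X]
    [TopologicalSpace.NoetherianSpace X] (U Z : Set X) (hU : IsOpen U) (hZU : Z ⊆ U)
    (hZ : closure Z ∩ U ⊆ Z) (x : X) (hx : x ∈ closure Z) : ∃ w ∈ Z, w ⤳ x := by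
  have : TopologicalSpace.NoetherianSpace ↥Z :=
    Topology.IsInducing.subtypeVal.noetherianSpace
  obtain ⟨S, hSf, -, hS, hu⟩ :=
    TopologicalSpace.NoetherianSpace.exists_finite_set_isClosed_irreducible
      (isClosed_univ : IsClosed (Set.univ : Set ↥Z))
  have hZe : Z = ⋃ t ∈ S, Subtype.val '' t := by
    rw [← Set.image_iUnion₂, ← Set.sUnion_eq_biUnion, ← hu, Set.image_univ, Subtype.range_val]
  rw [hZe, hSf.closure_biUnion, Set.mem_iUnion₂] at hx
  obtain ⟨t, ht, hxt⟩ := hx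
  have hi : IsIrreducible (Subtype.val '' t) :=
    (hS t ht).image _ continuous_subtype_val.continuousOn
  have hg := hi.isGenericPoint_genericPoint_closure
  refine ⟨hi.genericPoint, hZ ⟨?_, ?_⟩, hg.specializes hxt⟩
  · exact closure_mono (by rintro _ ⟨a, -, rfl⟩; exact a.2) hg.mem
  · obtain ⟨a, ha⟩ := (hS t ht).nonempty
    exact (hg.specializes (subset_closure ⟨a, ha, rfl⟩)).mem_open hU (hZU a.2)

/-- Lemma 8.2: let `B` be a noetherian separated scheme of Krull dimension 1, `z ∈ B` a
closed point and `U = B - z`. Let `f : X ⟶ B` be of finite type with `f⁻¹(z)` and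
`f⁻¹(U)` nonempty. If `Z_U` is a closed subset of the subspace `f⁻¹(U)` which contains no
irreducible component of any fiber over `U`, then the closure `Z` of `Z_U` in `X`
contains no irreducible component of the fiber `f⁻¹(z)`. -/
theorem closure_positive_codimension_over_closed_point
    (B X : Scheme) [AlgebraicGeometry.IsNoetherian B]
    (hsep : IsSeparated (terminal.from B))
    (hdim : topologicalKrullDim B = 1)
    (z : B) (hz : IsClosed ({z} : Set B))
    (f : X ⟶ B) [LocallyOfFiniteType f] [QuasiCompact f]
    (hfz : (f.base ⁻¹' {z}).Nonempty)
    (hfU : (f.base ⁻¹' {z}ᶜ).Nonempty)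
    (ZU : Set X) (hZU_sub : ZU ⊆ f.base ⁻¹' {z}ᶜ)
    (hZU_closed : IsClosed (Subtype.val ⁻¹' ZU : Set ↥(f.base ⁻¹' {z}ᶜ)))
    (hcodim : ∀ σ : B, σ ≠ z →
      ∀ T ∈ irreducibleComponents ↥(f.base ⁻¹' {σ}),
        ¬ T ⊆ (Subtype.val ⁻¹' ZU : Set ↥(f.base ⁻¹' {σ}))) :
    ∀ T ∈ irreducibleComponents ↥(f.base ⁻¹' {z}),
      ¬ T ⊆ (Subtype.val ⁻¹' closure ZU : Set ↥(f.base ⁻¹' {z})) := by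
  have : IsLocallyNoetherian X := LocallyOfFiniteType.isLocallyNoetherian f
  have : CompactSpace X := QuasiCompact.compactSpace_of_compactSpace f
  have : AlgebraicGeometry.IsNoetherian X := { }
  have hfc : Continuous f.base := f.continuous
  have hUo : IsOpen (f.base ⁻¹' {z}ᶜ) := hz.isOpen_compl.preimage hfc
  have hZ : closure ZU ∩ (f.base ⁻¹' {z}ᶜ) ⊆ ZU := by
    rintro p ⟨hp, hpU⟩
    obtain ⟨C, hC, hCe⟩ := isClosed_induced_iff.1 hZU_closed
    have hsub : ZU ⊆ C := by
      intro q hq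
      have : (⟨q, hZU_sub hq⟩ : ↥(f.base ⁻¹' {z}ᶜ)) ∈ Subtype.val ⁻¹' C := by
        rw [hCe]; exact hq
      exact this
    have : (⟨p, hpU⟩ : ↥(f.base ⁻¹' {z}ᶜ)) ∈ Subtype.val ⁻¹' C :=
      closure_minimal hsub hC hp
    rw [hCe] at this
    exact this
  intro T hT hTZ
  obtain ⟨x, hxz, hgx⟩ := fiber_generic f.base hfc z T hT.1
  have hTcl := isClosed_of_mem_irreducibleComponents T hT
  have hxcl : x ∈ closure ZU := by
    refine closure_minimal ?_ isClosed_closure hgx.mem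
    rintro _ ⟨t, ht, rfl⟩
    exact hTZ ht
  obtain ⟨w, hwZ, hwx⟩ := exists_specializes_of_mem_closure _ ZU hUo hZU_sub hZ x hxcl
  have hwne : f.base w ≠ z := hZU_sub hwZ
  let w₀ : ↥(f.base ⁻¹' {f.base w}) := ⟨w, rfl⟩
  have hcomp := irreducibleComponent_mem_irreducibleComponents w₀
  obtain ⟨y, hyw, hgy⟩ := fiber_generic f.base hfc (f.base w) _ hcomp.1
  have hyw' : y ⤳ w := hgy.specializes (subset_closure ⟨w₀, mem_irreducibleComponent, rfl⟩)
  refine key_chain f y w x hyw' hwx ?_ ?_ ?_ ?_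
  · rintro rfl
    refine hcodim _ hwne _ hcomp ?_
    intro t ht
    refine hZ ⟨?_, ?_⟩
    · have := hgy.specializes (subset_closure ⟨t, ht, rfl⟩)
      exact this.mem_closed isClosed_closure (subset_closure hwZ)
    · have h := t.2
      intro h'
      exact hwne (h.symm.trans h')
  · intro h
    exact hwne (h.trans hxz)
  · intro b hb1 hb2
    have := dim_one_between hdim _ _ _ hb1 hb2
    rcases this with h | h
    · exact Or.inl (h.trans hyw)
    · exact Or.inr h
  · intro p hpx hp
    have hpz : f.base p = z := hp.trans hxz
    let p₀ : ↥(f.base ⁻¹' {z}) := ⟨p, hpz⟩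
    have hsub : T ⊆ closure {p₀} := by
      intro t ht
      rw [← specializes_iff_mem_closure, ← Topology.IsInducing.subtypeVal.specializes_iff]
      exact hpx.trans (hgx.specializes (subset_closure ⟨t, ht, rfl⟩))
    have hp₀ : p₀ ∈ T :=
      hT.2 isIrreducible_singleton.closure hsub (subset_closure rfl)
    exact (hpx.antisymm (hgx.specializes (subset_closure ⟨p₀, hp₀, rfl⟩))).eq
end

section
/- Let R be a commutative ring, let S be a commutative R-algebra, and let J be an ideal of S such that (S, J) is a henselian pair. Let A be a smooth R-algebra, i.e., A is of finite presentation and formally smooth over R. Then the natural map Hom_{R-alg}(A, S) → Hom_{R-alg}(A, S/J), given by composition with the quotient map S → S/J, is surjective: every R-algebra homomorphism A → S/J lifts to an R-algebra homomorphism A → S. (Lemma B.10, affine-algebraic form) -/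
universe u

section

open Polynomial TensorProduct

namespace HenselLift

/-- Zariski main theorem, semi-global form along a section over `S/J`. -/
lemma exists_integral_one {S E : Type u} [CommRing S] [CommRing E] [Algebra S E]
    [Algebra.Etale S E] (J : Ideal S) (σ : E →ₐ[S] S ⧸ J) :
    ∃ r : E, IsIntegral S r ∧ σ r = 1 ∧ ∀ x, ∃ m, IsIntegral S (r ^ m * x) := by
  let C := integralClosure S E
  let I₀ : Ideal C :=
    { carrier := {r | ∀ x : E, ∃ m, IsIntegral S (r.1 ^ m * x)}
      zero_mem' := fun x => ⟨1, by simpa using isIntegral_zero⟩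
      add_mem' := by
        rintro ⟨a, ha⟩ ⟨b, hb⟩ h1 h2 x
        obtain ⟨m, hm⟩ := h1 x
        obtain ⟨k, hk⟩ := h2 x
        refine ⟨m + k, ?_⟩
        change IsIntegral S ((a + b) ^ (m + k) * x)
        rw [add_pow, Finset.sum_mul]
        refine IsIntegral.sum _ fun i hi => ?_
        have hi' : i ≤ m + k := by simpa [Nat.lt_succ_iff] using hi
        have hn : IsIntegral S (((m + k).choose i : ℕ) : E) :=
          (integralClosure S E).natCast_mem _
        rcases le_total m i with h | h
        · obtain ⟨j, rfl⟩ := Nat.exists_eq_add_of_le h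
          have := (((IsIntegral.pow ha j).mul (IsIntegral.pow hb (m + k - (m + j)))).mul hn).mul hm
          convert this using 1
          simp only
          ring
        · have h3 : m + k - i = (m - i) + k := by omega
          have := (((IsIntegral.pow ha i).mul (IsIntegral.pow hb (m - i))).mul hn).mul hk
          convert this using 1
          rw [h3]
          simp only
          ring
      smul_mem' := by
        rintro ⟨c, hc⟩ ⟨a, ha⟩ h1 x
        obtain ⟨m, hm⟩ := h1 x
        refine ⟨m, ?_⟩
        change IsIntegral S ((c * a) ^ m * x)
        rw [mul_pow, mul_assoc]
        exact (IsIntegral.pow hc m).mul hm }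
  let σC : C →+* S ⧸ J := σ.toRingHom.comp C.val.toRingHom
  have hs : Function.Surjective σC := by
    intro y
    obtain ⟨s, rfl⟩ := Ideal.Quotient.mk_surjective y
    exact ⟨algebraMap S C s, σ.commutes s⟩
  have htop : I₀.map σC = ⊤ := by
    by_contra hne
    obtain ⟨m, hm, hle⟩ := Ideal.exists_le_maximal _ hne
    have hp : (m.comap σ.toRingHom).IsPrime := inferInstance
    obtain ⟨r, hr, hri, hrx⟩ := Algebra.zariskisMainProperty_iff.mp
      (Algebra.ZariskisMainProperty.of_finiteType (R := S) (m.comap σ.toRingHom))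
    apply hr
    have : σC ⟨r, hri⟩ ∈ I₀.map σC := Ideal.mem_map_of_mem _ (show _ ∈ I₀ from hrx)
    exact hle this
  have h1 : (1 : S ⧸ J) ∈ I₀.map σC := htop ▸ Submodule.mem_top
  obtain ⟨r, hr, hr1⟩ := (Ideal.mem_map_iff_of_surjective σC hs).mp h1
  exact ⟨r.1, r.2, hr1, hr⟩

lemma exists_eps {S E : Type u} [CommRing S] [CommRing E] [Algebra S E]
    [Algebra.Etale S E] (J : Ideal S) (σ : E →ₐ[S] S ⧸ J) :
    ∃ ε : E, σ ε = 1 ∧ ∀ x s, σ x = Ideal.Quotient.mk J s →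
      ε * (x - algebraMap S E s) ∈ J.map (algebraMap S E) := by
  obtain ⟨t, ht, ht1⟩ := (Algebra.FormallyUnramified.iff_exists_tensorProduct
    (R := S) (S := E)).mp inferInstance
  let JE := J.map (algebraMap S E)
  let q : E →ₐ[S] E ⧸ JE := Ideal.Quotient.mkₐ S JE
  let j : S ⧸ J →ₐ[S] E ⧸ JE := Ideal.Quotient.liftₐ J (Algebra.ofId S (E ⧸ JE)) (by
    intro a ha
    change Ideal.Quotient.mk JE (algebraMap S E a) = 0
    exact Ideal.Quotient.eq_zero_iff_mem.mpr (Ideal.mem_map_of_mem _ ha))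
  let σ' : E ⧸ JE →ₐ[S] S ⧸ J := Ideal.Quotient.liftₐ JE σ (by
    intro a ha
    have : JE ≤ RingHom.ker σ := by
      refine Ideal.map_le_iff_le_comap.mpr fun s hs => ?_
      rw [Ideal.mem_comap, RingHom.mem_ker, AlgHom.commutes]
      exact Ideal.Quotient.eq_zero_iff_mem.mpr hs
    exact this ha)
  let Φ : E ⊗[S] E →ₐ[S] E ⧸ JE := Algebra.TensorProduct.lift q (j.comp σ) (fun _ _ => .all _ _)
  have hj : ∀ s, j (Ideal.Quotient.mk J s) = Ideal.Quotient.mk JE (algebraMap S E s) := fun s => rfl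
  have hσj : ∀ y, σ' (j y) = y := by
    intro y
    obtain ⟨s, rfl⟩ := Ideal.Quotient.mk_surjective y
    rw [hj]
    exact σ.commutes s
  have hcomp : σ'.comp Φ = σ.comp (Algebra.TensorProduct.lmul' S) := by
    ext x
    · simp only [Algebra.TensorProduct.lift_comp_includeLeft, Φ, AlgHom.comp_assoc]
      simp [σ', q]
      rfl
    · simp [Φ, hσj]
  obtain ⟨ε, hε⟩ := Ideal.Quotient.mk_surjective (Φ t)
  refine ⟨ε, ?_, ?_⟩
  · have := congr($hcomp t)
    simp only [AlgHom.comp_apply, ht1, map_one, ← hε] at this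
    exact this
  · intro x s hx
    have := congr(Φ $(ht x))
    rw [map_mul, map_zero, ← hε] at this
    have h2 : Φ (1 ⊗ₜ[S] x - x ⊗ₜ[S] 1) = Ideal.Quotient.mk JE (algebraMap S E s - x) := by
      simp [Φ, q, hx, hj]
    rw [h2, ← map_mul, Ideal.Quotient.eq_zero_iff_mem] at this
    convert neg_mem this using 1
    ring

lemma exists_good {S E : Type u} [CommRing S] [CommRing E] [Algebra S E]
    [Algebra.Etale S E] (J : Ideal S) (σ : E →ₐ[S] S ⧸ J) :
    ∃ u : E, IsIntegral S u ∧ σ u = 1 ∧ (∀ x, ∃ m, IsIntegral S (u ^ m * x)) ∧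
      ∀ x s, σ x = Ideal.Quotient.mk J s →
      u * (x - algebraMap S E s) ∈ J.map (algebraMap S E) := by
  obtain ⟨r, hr, hr1, hrx⟩ := exists_integral_one J σ
  obtain ⟨ε, hε1, hε⟩ := exists_eps J σ
  obtain ⟨m, hm⟩ := hrx ε
  have hu : IsIntegral S (r * (r ^ m * ε)) := hr.mul hm
  refine ⟨r * (r ^ m * ε), hu, by simp [hr1, hε1], fun x => ?_, fun x s hx => ?_⟩
  · obtain ⟨k, hk⟩ := hrx x
    refine ⟨k, ?_⟩
    have := (hm.pow k).mul hk
    convert this using 1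
    ring
  · have := Ideal.mul_mem_left _ (r * r ^ m) (hε x s hx)
    convert this using 1
    ring

lemma exists_subalgebra {S E : Type u} [CommRing S] [CommRing E] [Algebra S E]
    [Algebra.FiniteType S E] (u : E) (hu : IsIntegral S u)
    (h : ∀ x, ∃ m, IsIntegral S (u ^ m * x)) :
    ∃ B : Subalgebra S E, B.toSubmodule.FG ∧ u ∈ B ∧ ∀ x, ∃ m, u ^ m * x ∈ B := by
  classical
  obtain ⟨s, hs⟩ := Algebra.FiniteType.out (R := S) (A := E)
  choose m hm using h
  let t : Finset E := insert u (s.image fun x => u ^ m x * x)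
  refine ⟨Algebra.adjoin S (t : Set E), ?_, Algebra.subset_adjoin (by simp [t]), ?_⟩
  · apply fg_adjoin_of_finite t.finite_toSet
    intro x hx
    simp only [t, Finset.coe_insert, Finset.coe_image, Set.mem_insert_iff, Set.mem_image] at hx
    rcases hx with rfl | ⟨y, -, rfl⟩
    · exact hu
    · exact hm y
  · set B := Algebra.adjoin S (t : Set E)
    have huB : u ∈ B := Algebra.subset_adjoin (by simp [t])
    intro x
    have hx : x ∈ Algebra.adjoin S (s : Set E) := hs ▸ Algebra.mem_top
    induction hx using Algebra.adjoin_induction with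
    | mem x hx =>
      exact ⟨m x, Algebra.subset_adjoin (by
        simp only [t, Finset.coe_insert, Finset.coe_image]
        exact Or.inr ⟨x, hx, rfl⟩)⟩
    | algebraMap r => exact ⟨0, by simp⟩
    | add x y _ _ hx hy =>
      obtain ⟨a, ha⟩ := hx
      obtain ⟨b, hb⟩ := hy
      refine ⟨a + b, ?_⟩
      have := B.add_mem (B.mul_mem (B.pow_mem huB b) ha) (B.mul_mem (B.pow_mem huB a) hb)
      convert this using 1
      ring
    | mul x y _ _ hx hy =>
      obtain ⟨a, ha⟩ := hx
      obtain ⟨b, hb⟩ := hy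
      refine ⟨a + b, ?_⟩
      have := B.mul_mem ha hb
      convert this using 1
      ring

lemma mul_mem_smul {S E : Type u} [CommRing S] [CommRing E] [Algebra S E]
    (J : Ideal S) (B : Subalgebra S E) {x z : E} (hx : x ∈ B) (hz : z ∈ J • B.toSubmodule) :
    x * z ∈ J • B.toSubmodule := by
  induction hz using Submodule.smul_induction_on' with
  | smul r hr n hn =>
    rw [mul_smul_comm]
    exact Submodule.smul_mem_smul hr (B.mul_mem hx hn)
  | add a _ b _ ha hb => rw [mul_add]; exact add_mem ha hb

lemma exists_pow_mul_mem {S E : Type u} [CommRing S] [CommRing E] [Algebra S E]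
    (J : Ideal S) (B : Subalgebra S E) (u : E) (hu : u ∈ B) (h : ∀ x, ∃ m, u ^ m * x ∈ B)
    (z : E) (hz : z ∈ J.map (algebraMap S E)) : ∃ m, u ^ m * z ∈ J • B.toSubmodule := by
  unfold Ideal.map at hz
  induction hz using Submodule.span_induction with
  | mem x hx =>
    obtain ⟨s, hs, rfl⟩ := hx
    refine ⟨0, ?_⟩
    rw [pow_zero, one_mul, Algebra.algebraMap_eq_smul_one]
    exact Submodule.smul_mem_smul hs B.one_mem
  | zero => exact ⟨0, by simp⟩
  | add x y _ _ hx hy =>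
    obtain ⟨a, ha⟩ := hx
    obtain ⟨b, hb⟩ := hy
    refine ⟨a + b, ?_⟩
    have := add_mem (mul_mem_smul J B (B.pow_mem hu b) ha) (mul_mem_smul J B (B.pow_mem hu a) hb)
    convert this using 1
    ring
  | smul c x _ hx =>
    obtain ⟨a, ha⟩ := hx
    obtain ⟨b, hb⟩ := h c
    refine ⟨a + b, ?_⟩
    have := mul_mem_smul J B hb ha
    convert this using 1
    rw [smul_eq_mul]
    ring


lemma charpoly_mod {S : Type u} [CommRing S] (J : Ideal S) (n : ℕ)
    (M : Matrix (Fin (n + 1)) (Fin (n + 1)) S) (s : Fin (n + 1) → S) (h0 : s 0 = 1)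
    (hM : ∀ i k, M i k - (if k = 0 then s i else 0) ∈ J) :
    M.charpoly.map (Ideal.Quotient.mk J) = X ^ n * (X - 1) := by
  rw [← Matrix.charpoly_map]
  have hM' : M.map (Ideal.Quotient.mk J) =
      Matrix.of fun i k => if k = 0 then Ideal.Quotient.mk J (s i) else 0 := by
    ext i k
    simp only [Matrix.map_apply, Matrix.of_apply]
    rw [Ideal.Quotient.mk_eq_mk_iff_sub_mem (M i k) (if k = 0 then s i else 0) |>.mpr (hM i k)]
    split_ifs <;> simp
  rw [hM', Matrix.charpoly, Matrix.det_of_isLowerTriangular]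
  · rw [Fin.prod_univ_succ]
    simp [h0, mul_comm]
  · intro i j hij
    have hij' : i < j := hij
    have hj : j ≠ 0 := by rintro rfl; exact absurd hij' (by simp)
    simp [hj, hij'.ne]

lemma aeval_charpoly_eq_zero {S E : Type u} [CommRing S] [CommRing E] [Algebra S E] (n : ℕ)
    (M : Matrix (Fin n) (Fin n) S) (v : Fin n → E) (b : E)
    (h : ∀ i, b * v i = ∑ k, M i k • v k) (i : Fin n) : aeval b M.charpoly * v i = 0 := by
  set N : Matrix (Fin n) (Fin n) E := (aeval b).mapMatrix M.charmatrix with hN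
  have hdet : aeval b M.charpoly = N.det := by
    rw [Matrix.charpoly, AlgHom.map_det]
  have hNv : N.mulVec v = 0 := by
    ext i
    have : ∀ k, N i k = (if i = k then b else 0) - algebraMap S E (M i k) := by
      intro k
      simp only [hN, AlgHom.mapMatrix_apply, Matrix.map_apply, Matrix.charmatrix_apply, map_sub,
        aeval_C, Matrix.diagonal_apply]
      split_ifs <;> simp
    simp only [Matrix.mulVec, dotProduct, this, sub_mul, Finset.sum_sub_distrib, Pi.zero_apply,
      ite_mul, zero_mul, Finset.sum_ite_eq, Finset.mem_univ, if_true, h i, Algebra.smul_def, sub_self]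
  have := congr(N.adjugate.mulVec $hNv)
  rw [Matrix.mulVec_mulVec, Matrix.adjugate_mul, Matrix.mulVec_zero, Matrix.smul_mulVec,
    Matrix.one_mulVec] at this
  rw [hdet]
  exact congrFun this i

lemma exists_root_data {S : Type u} [CommRing S] (J : Ideal S) [HenselianRing S J] (n : ℕ)
    (f : S[X]) (hf : f.Monic) (hfm : f.map (Ideal.Quotient.mk J) = X ^ n * (X - 1)) :
    ∃ (a : S) (g : S[X]), f = (X - C a) * g ∧ a - 1 ∈ J ∧ IsUnit (g.eval a) ∧ IsUnit a := by
  have hunit : ∀ x : S, x - 1 ∈ J → IsUnit x := by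
    intro x hx
    have := (Ideal.mem_jacobson_bot.mp (HenselianRing.jac hx)) 1
    simpa using this
  have e1 : f.eval 1 ∈ J := by
    rw [← Ideal.Quotient.eq_zero_iff_mem, ← Polynomial.eval_map_apply, hfm]
    simp
  have e2 : Ideal.Quotient.mk J (f.derivative.eval 1) = 1 := by
    rw [← Polynomial.eval_map_apply, ← Polynomial.derivative_map, hfm]
    simp [derivative_mul]
  obtain ⟨a, ha, haJ⟩ := HenselianRing.is_henselian f hf 1 e1 (by rw [e2]; exact isUnit_one)
  refine ⟨a, f /ₘ (X - C a), (mul_divByMonic_eq_iff_isRoot.mpr ha).symm, haJ, ?_, hunit a haJ⟩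
  set g := f /ₘ (X - C a)
  have hfg : f = (X - C a) * g := (mul_divByMonic_eq_iff_isRoot.mpr ha).symm
  apply hunit
  have : f.derivative.eval a = g.eval a := by rw [hfg]; simp [derivative_mul]
  rw [← this, ← Ideal.Quotient.mk_eq_mk_iff_sub_mem, map_one, ← e2, ← Polynomial.eval_map_apply,
    ← Polynomial.eval_map_apply, Ideal.Quotient.mk_eq_mk_iff_sub_mem a 1 |>.mpr haJ]

lemma exists_idem {S E : Type u} [CommRing S] [CommRing E] [Algebra S E]
    [Algebra.Etale S E] (J : Ideal S) [HenselianRing S J] (σ : E →ₐ[S] S ⧸ J) :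
    ∃ e : E, IsIdempotentElem e ∧ σ e = 1 ∧ ∀ x, ∃ s : S, e * x = s • e := by
  obtain ⟨u, hu, hu1, hux, huJ⟩ := exists_good J σ
  obtain ⟨B, hB, huB, hBx⟩ := exists_subalgebra u hu hux
  obtain ⟨n, v, hv⟩ := Submodule.fg_iff_exists_fin_generating_family.mp hB
  have hvB : ∀ i, v i ∈ B := fun i => by
    rw [← Subalgebra.mem_toSubmodule, ← hv]; exact Submodule.subset_span ⟨i, rfl⟩
  have hs : ∀ x, ∃ s, σ x = Ideal.Quotient.mk J s := fun x =>
    (Ideal.Quotient.mk_surjective (σ x)).imp fun _ h => h.symm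
  choose s hs using fun i => hs (v i)
  choose m hm using fun i => exists_pow_mul_mem J B u huB hBx _ (huJ _ _ (hs i))
  obtain ⟨m₀, hm₀⟩ := exists_pow_mul_mem J B u huB hBx _ (huJ u 1 (by simpa using hu1))
  let N := m₀ + ∑ i, m i + 1
  let b := u ^ N
  have hbB : b ∈ B := B.pow_mem huB N
  have hσb : σ b = 1 := by simp [b, hu1]
  have hbv : ∀ i, b * v i - s i • b ∈ J • B.toSubmodule := by
    intro i
    have hle : m i ≤ ∑ i, m i := Finset.single_le_sum (fun _ _ => Nat.zero_le _) (Finset.mem_univ i)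
    have hN : N = (m₀ + (∑ i, m i - m i)) + m i + 1 := by omega
    have := mul_mem_smul J B (B.pow_mem huB (m₀ + (∑ i, m i - m i))) (hm i)
    convert this using 1
    rw [Algebra.smul_def]
    simp only [b]
    rw [hN]
    ring
  have hb1 : ∀ k, b * u ^ k - b ∈ J • B.toSubmodule := by
    intro k
    induction k with
    | zero => simp
    | succ k ih =>
      have h1 := mul_mem_smul J B (B.pow_mem huB (∑ i, m i + k)) hm₀
      have := add_mem ih h1
      convert this using 1
      simp only [b, N, map_one]
      ring
  let v' : Fin (n + 1) → E := Fin.cons b v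
  let s' : Fin (n + 1) → S := Fin.cons 1 s
  have hspan : Submodule.span S (Set.range v') = B.toSubmodule := by
    apply le_antisymm
    · rw [Submodule.span_le]
      rintro _ ⟨i, rfl⟩
      refine Fin.cases ?_ (fun i => ?_) i
      · exact hbB
      · exact hvB i
    · rw [← hv, Submodule.span_le]
      rintro _ ⟨i, rfl⟩
      exact Submodule.subset_span ⟨i.succ, rfl⟩
  have hbv' : ∀ i, b * v' i - s' i • b ∈ J • Submodule.span S (Set.range v') := by
    rw [hspan]
    intro i
    refine Fin.cases ?_ (fun i => ?_) i
    · simpa [v', s'] using hb1 N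
    · simpa [v', s'] using hbv i
  have hc : ∀ i, ∃ c : Fin (n + 1) → S, (∀ k, c k ∈ J) ∧ b * v' i - s' i • b = ∑ k, c k • v' k := by
    intro i
    obtain ⟨a, ha, hsum⟩ := (Submodule.mem_ideal_smul_span_iff_exists_sum J v' _).mp (hbv' i)
    refine ⟨a, ha, ?_⟩
    rw [← hsum, Finsupp.sum_fintype]
    simp
  choose c hcJ hc using hc
  let M : Matrix (Fin (n + 1)) (Fin (n + 1)) S :=
    Matrix.of fun i k => (if k = 0 then s' i else 0) + c i k
  have hMv : ∀ i, b * v' i = ∑ k, M i k • v' k := by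
    intro i
    simp only [M, Matrix.of_apply, add_smul, Finset.sum_add_distrib, ← hc i, ite_smul, zero_smul,
      Finset.sum_ite_eq', Finset.mem_univ, if_true]
    simp [v']
  have hmod := charpoly_mod J n M s' rfl (fun i k => by simpa [M] using hcJ i k)
  obtain ⟨a, g, hfg, haJ, ⟨w, hw⟩, ⟨a', ha'⟩⟩ :=
    exists_root_data J n M.charpoly (Matrix.charpoly_monic M) hmod
  have hfb : aeval b M.charpoly = 0 := by
    have h1 : ∀ y ∈ Submodule.span S (Set.range v'), aeval b M.charpoly * y = 0 := by
      intro y hy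
      induction hy using Submodule.span_induction with
      | mem x hx =>
        obtain ⟨i, rfl⟩ := hx
        exact aeval_charpoly_eq_zero _ M v' b hMv i
      | zero => simp
      | add x y _ _ hx hy => rw [mul_add, hx, hy, add_zero]
      | smul r x _ hx => rw [mul_smul_comm, hx, smul_zero]
    simpa using h1 1 (hspan ▸ B.one_mem)
  have hbg : (b - algebraMap S E a) * aeval b g = 0 := by
    rw [← hfb, hfg]; simp
  let e : E := algebraMap S E ↑w⁻¹ * aeval b g
  have hbe : b * e = algebraMap S E a * e := by
    rw [← sub_eq_zero, ← sub_mul]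
    simp only [e]
    rw [mul_left_comm, hbg, mul_zero]
  obtain ⟨q, hq⟩ : (X - C a) ∣ g - C (g.eval a) := X_sub_C_dvd_sub_C_eval
  have hge : aeval b g * e = algebraMap S E (g.eval a) * e := by
    have := congr_arg (fun z => aeval b z * e) hq
    simp only [map_sub, map_mul, aeval_X, aeval_C] at this
    rw [← sub_eq_zero, ← sub_mul, this, mul_right_comm, sub_mul, hbe, sub_self, zero_mul]
  have hwe : algebraMap S E ↑w⁻¹ * algebraMap S E (g.eval a) = 1 := by
    rw [← map_mul, ← hw, Units.inv_mul, map_one]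
  have hee : IsIdempotentElem e := by
    change (algebraMap S E ↑w⁻¹ * aeval b g) * e = e
    rw [mul_assoc, hge, ← mul_assoc, hwe, one_mul]
  have hσe : σ e = 1 := by
    have h1 : σ (aeval b g) = σ (algebraMap S E (g.eval a)) := by
      rw [← Polynomial.aeval_algHom_apply, hσb, AlgHom.commutes, Ideal.Quotient.algebraMap_eq,
        ← Polynomial.eval_map_apply, Ideal.Quotient.mk_eq_mk_iff_sub_mem a 1 |>.mpr haJ, map_one,
        aeval_def, eval_map, Ideal.Quotient.algebraMap_eq]
    rw [map_mul, h1, ← map_mul, hwe, map_one]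
  refine ⟨e, hee, hσe, ?_⟩
  -- the inverse of `a`
  have hea : ∀ y, e * y = algebraMap S E ↑a'⁻¹ * (b * e * y) := by
    intro y
    rw [hbe, ← mul_assoc, ← mul_assoc, ← map_mul, ← ha', Units.inv_mul, map_one, one_mul]
  let Ne : Submodule S E := B.toSubmodule.map (LinearMap.mulLeft S e)
  have hNe : ∀ y, e * y ∈ Ne := by
    intro y
    obtain ⟨k, hk⟩ := hBx y
    have h1 : ∀ k, e * y = algebraMap S E (↑a'⁻¹ ^ k) * (e * (b ^ k * y)) := by
      intro k
      induction k with
      | zero => simp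
      | succ k ih =>
        have h2 := hea (b ^ k * y)
        rw [ih, h2]
        simp only [map_pow]
        ring
    rw [h1 k, ← Algebra.smul_def]
    refine Submodule.smul_mem _ _ ⟨b ^ k * y, ?_, rfl⟩
    have : b ^ k * y = u ^ ((N - 1) * k) * (u ^ k * y) := by
      have hN1 : N * k = (N - 1) * k + k := by simp only [N]; simp; ring
      simp only [b]
      rw [← pow_mul, hN1, pow_add, mul_assoc]
    rw [this]
    exact B.mul_mem (B.pow_mem huB _) hk
  have hJE : ∀ z ∈ J.map (algebraMap S E), e * z ∈ J • Ne := by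
    intro z hz
    unfold Ideal.map at hz
    induction hz using Submodule.span_induction with
    | mem x hx =>
      obtain ⟨t, ht, rfl⟩ := hx
      rw [mul_comm, ← Algebra.smul_def, ← mul_one e]
      exact Submodule.smul_mem_smul ht (hNe 1)
    | zero => simp
    | add x y _ _ hx hy => rw [mul_add]; exact add_mem hx hy
    | smul d x _ hx =>
      rw [smul_eq_mul, mul_left_comm]
      have : ∀ z ∈ J • Ne, d * z ∈ J • Ne := by
        intro z hz
        induction hz using Submodule.smul_induction_on' with
        | smul r hr y hy =>
          obtain ⟨y', -, rfl⟩ := hy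
          rw [mul_smul_comm]
          refine Submodule.smul_mem_smul hr ?_
          rw [LinearMap.mulLeft_apply, mul_left_comm]
          exact hNe _
        | add x _ y _ hx hy => rw [mul_add]; exact add_mem hx hy
      exact this _ hx
  have hle : Ne ≤ Submodule.span S {e} := by
    refine Submodule.le_of_le_smul_of_le_jacobson_bot (I := J) (hB.map _) HenselianRing.jac ?_
    rintro _ ⟨x, -, rfl⟩
    obtain ⟨t, ht⟩ := Ideal.Quotient.mk_surjective (σ x)
    have h1 : b * (x - algebraMap S E t) ∈ J.map (algebraMap S E) := by
      have := Ideal.mul_mem_left _ (u ^ (N - 1)) (huJ x t ht.symm)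
      convert this using 1
      simp only [b, N]
      simp
      ring
    have h2 : e * x = t • e + algebraMap S E ↑a'⁻¹ * (e * (b * (x - algebraMap S E t))) := by
      have := hea (x - algebraMap S E t)
      rw [Algebra.smul_def]
      linear_combination this
    rw [LinearMap.mulLeft_apply, h2, ← Algebra.smul_def]
    exact Submodule.add_mem_sup (Submodule.smul_mem _ _ (Submodule.mem_span_singleton_self e))
      (Submodule.smul_mem _ _ (hJE _ h1))
  intro x
  obtain ⟨t, ht⟩ := Submodule.mem_span_singleton.mp (hle (hNe x))
  exact ⟨t, ht.symm⟩

/-- Étale algebras: sections over `S/J` lift. -/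
lemma etale_lift {S E : Type u} [CommRing S] [CommRing E] [Algebra S E]
    [Algebra.Etale S E] (J : Ideal S) [HenselianRing S J] (σ : E →ₐ[S] S ⧸ J) :
    ∃ φ : E →ₐ[S] S, ∀ x, Ideal.Quotient.mk J (φ x) = σ x := by
  obtain ⟨e, he, hσe, hex⟩ := exists_idem J σ
  let D := Localization.Away e
  have hetD : Algebra.Etale E D := inferInstance
  have hSD : Algebra.Etale S D := Algebra.Etale.comp S E D
  have he1 : algebraMap E D e = 1 := by
    have h1 : IsUnit (algebraMap E D e) := IsLocalization.Away.algebraMap_isUnit e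
    have h2 : algebraMap E D e * algebraMap E D e = algebraMap E D e * 1 := by
      rw [← map_mul, he.eq, mul_one]
    exact h1.mul_left_cancel h2
  have hsurj : Function.Surjective (Algebra.ofId S D) := by
    intro y
    obtain ⟨x, ⟨_, k, rfl⟩, rfl⟩ := IsLocalization.exists_mk'_eq (Submonoid.powers e) y
    obtain ⟨s, hs⟩ := hex x
    refine ⟨s, ?_⟩
    rw [eq_comm, IsLocalization.mk'_eq_iff_eq_mul]
    simp only [map_pow, he1, one_pow, mul_one]
    have := congr(algebraMap E D $hs)
    rw [map_mul, he1, one_mul, Algebra.smul_def, map_mul, he1, mul_one,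
      ← IsScalarTower.algebraMap_apply] at this
    exact this
  let τ : D →+* S ⧸ J := IsLocalization.Away.lift (S := D) e (g := σ.toRingHom)
    (by change IsUnit (σ e); rw [hσe]; exact isUnit_one)
  have hτ : ∀ x, τ (algebraMap E D x) = σ x := fun x => IsLocalization.Away.lift_eq _ _ _
  have hτS : ∀ s, τ (algebraMap S D s) = Ideal.Quotient.mk J s := fun s => by
    rw [IsScalarTower.algebraMap_apply S E D, hτ]; exact σ.commutes s
  let K : Ideal S := RingHom.ker (Algebra.ofId S D)
  have hKJ : K ≤ J := by
    intro k hk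
    rw [← Ideal.Quotient.eq_zero_iff_mem, ← hτS]
    have : algebraMap S D k = 0 := hk
    rw [this, map_zero]
  have hKfg : K.FG := Algebra.FinitePresentation.ker_fG_of_surjective _ hsurj
  -- `K = K²`
  have hK2 : K ≤ K ^ 2 := by
    obtain ⟨l, hl⟩ := (Algebra.FormallySmooth.iff_split_surjection (Algebra.ofId S D) hsurj).mp
      inferInstance
    intro k hk
    have h0 : algebraMap S D k = 0 := hk
    have h1 : l (algebraMap S D k) = algebraMap S _ k := l.commutes k
    rw [h0, map_zero] at h1
    exact Ideal.Quotient.eq_zero_iff_mem.mp h1.symm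
  have hK : K = ⊥ := by
    refine Submodule.eq_bot_of_le_smul_of_le_jacobson_bot J K hKfg ?_ HenselianRing.jac
    refine hK2.trans ?_
    rw [pow_two, smul_eq_mul]
    exact Ideal.mul_mono_left hKJ
  have hinj : Function.Injective (Algebra.ofId S D) :=
    (RingHom.injective_iff_ker_eq_bot (Algebra.ofId S D)).mpr hK
  let ψ : S ≃ₐ[S] D := AlgEquiv.ofBijective (Algebra.ofId S D) ⟨hinj, hsurj⟩
  refine ⟨ψ.symm.toAlgHom.comp (IsScalarTower.toAlgHom S E D), fun x => ?_⟩
  rw [← hτS, ← hτ]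
  congr 1
  exact ψ.apply_symm_apply _


/-- Multivariate Hensel lemma for square systems over a henselian pair. -/
lemma multi_hensel {S : Type u} [CommRing S] (J : Ideal S) [HenselianRing S J] {r : ℕ}
    (G : Fin r → MvPolynomial (Fin r) S)
    (hG : ∀ i, MvPolynomial.aeval (0 : Fin r → S) (G i) ∈ J)
    (hjac : IsUnit (Matrix.of fun i j =>
      MvPolynomial.aeval (0 : Fin r → S) (MvPolynomial.pderiv i (G j))).det) :
    ∃ y : Fin r → S, (∀ i, y i ∈ J) ∧ ∀ i, MvPolynomial.aeval y (G i) = 0 := by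
  let P := Algebra.PreSubmersivePresentation.naive (R := S) (v := G) id Function.injective_id
  let Δ := P.jacobian
  let Q := MvPolynomial (Fin r) S ⧸ Ideal.span (Set.range G)
  let E := Localization.Away Δ
  have hΔ : IsUnit (algebraMap Q E Δ) := IsLocalization.Away.algebraMap_isUnit _
  have : Algebra.Etale S E := by
    let P' : Algebra.SubmersivePresentation S E _ _ :=
      { toPreSubmersivePresentation := .comp (.localizationAway E Δ) P,
        jacobian_isUnit := by
          rw [Algebra.PreSubmersivePresentation.comp_jacobian_eq_jacobian_smul_jacobian,
            Algebra.PreSubmersivePresentation.localizationAway_jacobian, Algebra.smul_def]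
          exact hΔ.mul hΔ }
    have : Algebra.IsStandardSmoothOfRelativeDimension 0 S E :=
      P'.isStandardSmoothOfRelativeDimension (by
        simp only [Algebra.PreSubmersivePresentation.dimension_comp_eq_dimension_add_dimension, P']
        simp [Algebra.Presentation.dimension])
    infer_instance
  let q : MvPolynomial (Fin r) S →ₐ[S] S ⧸ J :=
    (Ideal.Quotient.mkₐ S J).comp (MvPolynomial.aeval 0)
  let σQ : Q →ₐ[S] S ⧸ J := Ideal.Quotient.liftₐ _ q (by
    intro a ha
    have : Ideal.span (Set.range G) ≤ RingHom.ker q := by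
      rw [Ideal.span_le]
      rintro _ ⟨i, rfl⟩
      exact Ideal.Quotient.eq_zero_iff_mem.mpr (hG i)
    exact this ha)
  have hσQ : ∀ p, σQ (Ideal.Quotient.mk _ p) = Ideal.Quotient.mk J (MvPolynomial.aeval 0 p) :=
    fun p => rfl
  have hσΔ : IsUnit (σQ Δ) := by
    have h1 : Δ = Ideal.Quotient.mk _ P.jacobiMatrix.det :=
      P.jacobian_eq_jacobiMatrix_det
    rw [h1, hσQ, AlgHom.map_det]
    refine IsUnit.map (Ideal.Quotient.mk J) ?_
    convert hjac using 2
    ext i j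
    simp [P]
  let σ : E →ₐ[S] S ⧸ J := IsLocalization.liftAlgHom (M := Submonoid.powers Δ) (f := σQ) (by
    rintro ⟨_, k, rfl⟩
    rw [map_pow]
    exact hσΔ.pow k)
  obtain ⟨φ, hφ⟩ := etale_lift J σ
  let ι : MvPolynomial (Fin r) S →ₐ[S] E :=
    (IsScalarTower.toAlgHom S Q E).comp (Ideal.Quotient.mkₐ S _)
  have hι : ∀ p, MvPolynomial.aeval (fun i => φ (ι (MvPolynomial.X i))) p = φ (ι p) := by
    intro p
    have : MvPolynomial.aeval (fun i => φ (ι (MvPolynomial.X i))) = φ.comp ι := by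
      ext i
      simp
    rw [this]; rfl
  refine ⟨fun i => φ (ι (MvPolynomial.X i)), fun i => ?_, fun i => ?_⟩
  · rw [← Ideal.Quotient.eq_zero_iff_mem, hφ]
    have : σ (ι (MvPolynomial.X i)) = σQ (Ideal.Quotient.mk _ (MvPolynomial.X i)) :=
      IsLocalization.lift_eq _ _
    rw [this, hσQ]
    simp
  · rw [hι]
    have : ι (G i) = 0 := by
      change algebraMap Q E (Ideal.Quotient.mk _ (G i)) = 0
      rw [Ideal.Quotient.eq_zero_iff_mem.mpr (Ideal.subset_span (Set.mem_range_self i)), map_zero]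
    rw [this, map_zero]

end HenselLift

end

namespace HenselLift

open MvPolynomial in
lemma taylor_sq {S : Type u} [CommRing S] {n : ℕ} (K : Ideal (MvPolynomial (Fin n) S))
    (h : Fin n → MvPolynomial (Fin n) S) (hh : ∀ j, h j - X j ∈ K) (p : MvPolynomial (Fin n) S) :
    aeval h p - p - ∑ j, pderiv j p * (h j - X j) ∈ K ^ 2 := by
  induction p using MvPolynomial.induction_on with
  | C a => simp [MvPolynomial.algebraMap_eq]
  | add p q hp hq =>
    have := add_mem hp hq
    convert this using 1
    simp only [map_add, add_mul, Finset.sum_add_distrib]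
    ring
  | mul_X p k hp =>
    have h1 : aeval h p - p ∈ K := by
      have h2 : ∑ j, pderiv j p * (h j - X j) ∈ K :=
        Ideal.sum_mem _ fun j _ => Ideal.mul_mem_left _ _ (hh j)
      have := add_mem (Ideal.pow_le_self two_ne_zero hp) h2
      convert this using 1
      ring
    have h3 : (aeval h p - p) * (h k - X k) ∈ K ^ 2 := by
      rw [pow_two]; exact Ideal.mul_mem_mul h1 (hh k)
    have := add_mem (Ideal.mul_mem_right (X k) _ hp) h3
    convert this using 1
    have h4 : ∑ j, pderiv j (p * X k) * (h j - X j) =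
        X k * (∑ j, pderiv j p * (h j - X j)) + p * (h k - X k) := by
      have : ∀ j, pderiv j (p * X k) * (h j - X j) =
          X k * (pderiv j p * (h j - X j)) + (if j = k then p * (h j - X j) else 0) := by
        intro j
        rw [pderiv_mul, pderiv_X]
        by_cases hjk : j = k
        · subst hjk
          simp
          ring
        · simp [hjk, Pi.single_apply, Ne.symm hjk]
          ring
      simp only [this, Finset.sum_add_distrib, Finset.mul_sum]
      simp
    rw [h4, map_mul, aeval_X]
    ring

open MvPolynomial in
lemma pderiv_sq {S : Type u} [CommRing S] {n : ℕ} (K : Ideal (MvPolynomial (Fin n) S))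
    (j : Fin n) (z : MvPolynomial (Fin n) S) (hz : z ∈ K ^ 2) : pderiv j z ∈ K := by
  rw [pow_two] at hz
  induction hz using Submodule.mul_induction_on' with
  | mem_mul_mem a ha b hb =>
    rw [pderiv_mul]
    exact add_mem (Ideal.mul_mem_left _ _ hb) (Ideal.mul_mem_right _ _ ha)
  | add x _ y _ hx hy => rw [map_add]; exact add_mem hx hy

open MvPolynomial in
lemma aeval_mem {S : Type u} [CommRing S] {n r : ℕ} (k : Fin r → MvPolynomial (Fin n) S)
    (x : Fin n → S) (z : MvPolynomial (Fin n) S) (hz : z ∈ Ideal.span (Set.range k)) :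
    aeval x z ∈ Ideal.span (Set.range fun i => aeval x (k i)) := by
  obtain ⟨c, rfl⟩ := Ideal.mem_span_range_iff_exists_fun.mp hz
  rw [map_sum]
  refine Ideal.sum_mem _ fun i _ => ?_
  rw [map_mul]
  exact Ideal.mul_mem_left _ _ (Ideal.subset_span (Set.mem_range_self i))

open MvPolynomial in
lemma smooth_lift_self {S A : Type u} [CommRing S] [CommRing A] [Algebra S A]
    [Algebra.FormallySmooth S A] [Algebra.FinitePresentation S A]
    (J : Ideal S) [HenselianRing S J] (σ : A →ₐ[S] S ⧸ J) :
    ∃ φ : A →ₐ[S] S, ∀ x, Ideal.Quotient.mk J (φ x) = σ x := by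
  obtain ⟨n, π, hπ, hfg⟩ := Algebra.FinitePresentation.out (R := S) (A := A)
  obtain ⟨r, k, hk⟩ := Submodule.fg_iff_exists_fin_generating_family.mp hfg
  set K : Ideal (MvPolynomial (Fin n) S) := RingHom.ker π.toRingHom with hKdef
  have hkK : ∀ i, k i ∈ K := fun i => by
    rw [← hk]; exact Ideal.subset_span (Set.mem_range_self i)
  have hK : Ideal.span (Set.range k) = K := hk
  -- the section modulo `K²`
  obtain ⟨l, hl⟩ := (Algebra.FormallySmooth.iff_split_surjection π hπ).mp inferInstance
  choose h hh using fun j => Ideal.Quotient.mk_surjective (l (π (X j)))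
  have hlift : ∀ p, Ideal.Quotient.mk (K ^ 2) (aeval h p) = l (π p) := by
    intro p
    have : (Ideal.Quotient.mkₐ S (K ^ 2)).comp (aeval h) = l.comp π := by
      ext j
      simp only [AlgHom.comp_apply, aeval_X]
      exact hh j
    exact congr($this p)
  have hX : ∀ j, h j - X j ∈ K := by
    intro j
    have h1 := congr($hl (π (X j)))
    rw [AlgHom.comp_apply, ← hh j] at h1
    have h2 : π (h j) = π (X j) := h1
    change π (h j - X j) = 0
    rw [map_sub, h2, sub_self]
  have hkh : ∀ i, aeval h (k i) ∈ K ^ 2 := by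
    intro i
    rw [← Ideal.Quotient.eq_zero_iff_mem, hlift]
    have : π (k i) = 0 := hkK i
    rw [this, map_zero]
  have hH : ∀ j, ∃ c : Fin r → MvPolynomial (Fin n) S, ∑ i, c i * k i = h j - X j := fun j =>
    Ideal.mem_span_range_iff_exists_fun.mp (hK ▸ hX j)
  choose H hH using hH
  let e : Fin r → Fin r → MvPolynomial (Fin n) S := fun i m => - ∑ j, pderiv j (k i) * H j m
  have hek : ∀ i, k i - ∑ m, e i m * k m ∈ K ^ 2 := by
    intro i
    have h1 := sub_mem (hkh i) (taylor_sq K h hX (k i))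
    convert h1 using 1
    have : ∑ m, e i m * k m = - ∑ j, pderiv j (k i) * (h j - X j) := by
      simp only [e, ← hH, neg_mul, Finset.sum_neg_distrib, Finset.sum_mul, Finset.mul_sum]
      rw [Finset.sum_comm]
      simp only [mul_assoc]
    rw [this]
    ring
  -- `(1 - e) e ∈ K`
  have hee : ∀ i m, e i m - ∑ t, e i t * e t m ∈ K := by
    intro i m
    have h1 : ∀ j, pderiv j (k i) - ∑ t, e i t * pderiv j (k t) ∈ K := by
      intro j
      have h2 := pderiv_sq K j _ (hek i)
      have h3 : ∑ t, pderiv j (e i t) * k t ∈ K :=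
        Ideal.sum_mem _ fun t _ => Ideal.mul_mem_left _ _ (hkK t)
      have := add_mem h2 h3
      convert this using 1
      simp only [map_sub, map_sum, pderiv_mul, Finset.sum_add_distrib]
      ring
    have h4 : - ∑ j, (pderiv j (k i) - ∑ t, e i t * pderiv j (k t)) * H j m ∈ K :=
      neg_mem (Ideal.sum_mem _ fun j _ => Ideal.mul_mem_right _ _ (h1 j))
    convert h4 using 1
    have h5 : ∑ t, e i t * e t m = - ∑ j, (∑ t, e i t * pderiv j (k t)) * H j m := by
      have : ∀ t, e i t * e t m = - ∑ j, e i t * pderiv j (k t) * H j m := by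
        intro t
        change e i t * (- ∑ j, pderiv j (k t) * H j m) = _
        rw [mul_neg, Finset.mul_sum]
        simp only [mul_assoc]
      simp only [this, Finset.sum_neg_distrib, Finset.sum_mul]
      rw [Finset.sum_comm]
    rw [h5]
    simp only [sub_mul, Finset.sum_sub_distrib]
    change - ∑ j, pderiv j (k i) * H j m - _ = _
    ring
  -- approximate solution
  choose x₀ hx₀ using fun j => Ideal.Quotient.mk_surjective (σ (π (X j)))
  have hx₀' : ∀ p, Ideal.Quotient.mk J (aeval x₀ p) = σ (π p) := by
    intro p
    have : (Ideal.Quotient.mkₐ S J).comp (aeval x₀) = σ.comp π := by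
      ext j
      simp only [AlgHom.comp_apply, aeval_X]
      exact hx₀ j
    exact congr($this p)
  have hk₀ : ∀ i, aeval x₀ (k i) ∈ J := by
    intro i
    rw [← Ideal.Quotient.eq_zero_iff_mem, hx₀']
    have : π (k i) = 0 := hkK i
    rw [this, map_zero]
  -- the square system
  let ξ : Fin n → MvPolynomial (Fin r) S := fun j => C (x₀ j) + ∑ m, C (aeval x₀ (H j m)) * X m
  let G : Fin r → MvPolynomial (Fin r) S := fun i =>
    aeval ξ (k i) - (X i - ∑ m, aeval ξ (e i m) * X m)
  have hcomp : ∀ (y : Fin r → S) (p : MvPolynomial (Fin n) S),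
      aeval y (aeval ξ p) = aeval (fun j => aeval y (ξ j)) p := by
    intro y p
    have : (aeval y).comp (aeval ξ) = aeval (R := S) (fun j => aeval y (ξ j)) := by
      ext j
      simp
    exact congr($this p)
  have hξ0 : (fun j => aeval (0 : Fin r → S) (ξ j)) = x₀ := by
    ext j
    simp [ξ]
  have hG0 : ∀ i, aeval (0 : Fin r → S) (G i) ∈ J := by
    intro i
    have : aeval (0 : Fin r → S) (G i) = aeval x₀ (k i) := by
      simp only [G, map_sub, map_sum, map_mul, hcomp, hξ0, aeval_X]
      simp
    rw [this]; exact hk₀ i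
  have hchain : ∀ (p : MvPolynomial (Fin n) S) (m : Fin r),
      pderiv m (aeval ξ p) = ∑ j, aeval ξ (pderiv j p) * pderiv m (ξ j) := by
    intro p m
    induction p using MvPolynomial.induction_on with
    | C a => simp [MvPolynomial.algebraMap_eq]
    | add p q hp hq => simp only [map_add, hp, hq, add_mul, Finset.sum_add_distrib]
    | mul_X p t hp =>
      have : ∀ j, aeval ξ (pderiv j (p * X t)) * pderiv m (ξ j) =
          aeval ξ (pderiv j p) * pderiv m (ξ j) * ξ t +
            (if j = t then aeval ξ p * pderiv m (ξ j) else 0) := by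
        intro j
        rw [pderiv_mul, pderiv_X]
        by_cases hjt : j = t
        · subst hjt
          simp
          ring
        · simp [hjt, Pi.single_apply, Ne.symm hjt]
          ring
      simp only [this, Finset.sum_add_distrib, ← Finset.sum_mul, ← hp]
      rw [map_mul, aeval_X, pderiv_mul]
      simp
  have hdξ : ∀ j m, pderiv m (ξ j) = C (aeval x₀ (H j m)) := by
    intro j m
    simp only [ξ, map_add, map_sum, pderiv_C, pderiv_C_mul, pderiv_X, zero_add]
    simp [Pi.single_apply, MvPolynomial.smul_eq_C_mul]
  have hjacM : (Matrix.of fun m i => aeval (0 : Fin r → S) (pderiv m (G i))) = -1 := by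
    ext m i
    have h1 : aeval (0 : Fin r → S) (pderiv m (aeval ξ (k i))) = - aeval x₀ (e i m) := by
      rw [hchain]
      simp only [hdξ, map_sum, map_mul, hcomp, hξ0, e, map_neg, neg_neg]
      simp
    have h2 : ∀ t, aeval (0 : Fin r → S) (pderiv m (aeval ξ (e i t) * X t)) =
        if t = m then aeval x₀ (e i t) else 0 := by
      intro t
      rw [pderiv_mul, pderiv_X, map_add, map_mul, map_mul, hcomp, hξ0]
      by_cases htm : t = m
      · subst htm; simp
      · simp [htm, Pi.single_apply, Ne.symm htm]
    simp only [Matrix.of_apply, G, map_sub, map_sum, h1, h2]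
    rw [pderiv_X]
    by_cases him : i = m
    · subst him; simp; ring
    · simp [him, Pi.single_apply, Ne.symm him]
  obtain ⟨y, hyJ, hy⟩ := multi_hensel J G hG0 (by
    rw [hjacM, Matrix.det_neg, Matrix.det_one, mul_one]
    exact isUnit_one.neg.pow _)
  let x : Fin n → S := fun j => aeval y (ξ j)
  have hxx₀ : ∀ j, x j - x₀ j ∈ J := by
    intro j
    have : x j - x₀ j = ∑ m, aeval x₀ (H j m) * y m := by simp [x, ξ]
    rw [this]
    exact Ideal.sum_mem _ fun m _ => Ideal.mul_mem_left _ _ (hyJ m)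
  have hkx : ∀ i, aeval x (k i) = y i - ∑ m, aeval x (e i m) * y m := by
    intro i
    have := hy i
    simp only [G, map_sub, map_sum, map_mul, hcomp, aeval_X] at this
    exact sub_eq_zero.mp this
  have hxp : ∀ p, Ideal.Quotient.mk J (aeval x p) = σ (π p) := by
    intro p
    rw [← hx₀']
    have : (Ideal.Quotient.mkₐ S J).comp (aeval x) = (Ideal.Quotient.mkₐ S J).comp (aeval x₀) := by
      ext j
      simp only [AlgHom.comp_apply, aeval_X]
      exact (Ideal.Quotient.mk_eq_mk_iff_sub_mem _ _).mpr (hxx₀ j)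
    exact congr($this p)
  let 𝔨 : Ideal S := Ideal.span (Set.range fun i => aeval x (k i))
  have h𝔨J : 𝔨 ≤ J := by
    rw [Ideal.span_le]
    rintro _ ⟨i, rfl⟩
    change aeval x (k i) ∈ J
    rw [← Ideal.Quotient.eq_zero_iff_mem, hxp]
    have : π (k i) = 0 := hkK i
    rw [this, map_zero]
  have hmem : ∀ z ∈ K, aeval x z ∈ 𝔨 := fun z hz => aeval_mem k x z (hK ▸ hz)
  have hmem2 : ∀ z ∈ K ^ 2, aeval x z ∈ J • 𝔨 := by
    intro z hz
    rw [pow_two] at hz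
    induction hz using Submodule.mul_induction_on' with
    | mem_mul_mem a ha b hb =>
      rw [map_mul]
      exact Submodule.smul_mem_smul (h𝔨J (hmem a ha)) (hmem b hb)
    | add a _ b _ ha hb => rw [map_add]; exact add_mem ha hb
  have h𝔨 : 𝔨 = ⊥ := by
    refine Submodule.eq_bot_of_le_smul_of_le_jacobson_bot J 𝔨
      ((Submodule.fg_span (Set.finite_range _))) ?_ HenselianRing.jac
    refine Ideal.span_le.mpr ?_
    rintro _ ⟨i, rfl⟩
    change aeval x (k i) ∈ J • 𝔨
    have h1 := hmem2 _ (hek i)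
    have h2 : ∑ m, aeval x (e i m - ∑ t, e i t * e t m) * y m ∈ J • 𝔨 :=
      sum_mem fun m _ => by
        rw [mul_comm]
        exact Submodule.smul_mem_smul (hyJ m) (hmem _ (hee i m))
    have := add_mem h1 h2
    convert this using 1
    have h3 : ∑ m, aeval x (e i m) * aeval x (k m) =
        ∑ m, aeval x (e i m - ∑ t, e i t * e t m) * y m := by
      simp only [hkx, map_sub, map_sum, map_mul, mul_sub, sub_mul, Finset.sum_sub_distrib,
        Finset.mul_sum, Finset.sum_mul]
      congr 1
      rw [Finset.sum_comm]
      simp only [mul_assoc]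
    rw [← h3]
    simp only [map_sub, map_sum, map_mul]
    ring
  have hker : ∀ z, π z = 0 → aeval x z = 0 := by
    intro z hz
    have := hmem z hz
    rwa [h𝔨, Ideal.mem_bot] at this
  let φ : A →ₐ[S] S := AlgHom.liftOfSurjective π hπ (aeval x) (fun z hz => hker z hz)
  refine ⟨φ, fun a => ?_⟩
  obtain ⟨p, rfl⟩ := hπ a
  have : φ (π p) = aeval x p := AlgHom.liftOfSurjective_apply _ _ _ _ _
  rw [this, hxp]

end HenselLift

/-- Lemma B.10 (affine-algebraic form): if `(S, J)` is a henselian pair and `A` is a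
smooth `R`-algebra, then every `R`-algebra map `A → S/J` lifts to `A → S`. -/
theorem smooth_lifts_along_henselian_pair
    (R S A : Type u) [CommRing R] [CommRing S] [CommRing A]
    [Algebra R S] [Algebra R A] (J : Ideal S) [HenselianRing S J]
    [Algebra.FormallySmooth R A] [Algebra.FinitePresentation R A] :
    Function.Surjective fun g : A →ₐ[R] S => (Ideal.Quotient.mkₐ R J).comp g := by
  intro f
  let σ : TensorProduct R S A →ₐ[S] S ⧸ J :=
    Algebra.TensorProduct.lift (Algebra.ofId S (S ⧸ J)) f (fun _ _ => Commute.all _ _)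
  obtain ⟨φ, hφ⟩ := HenselLift.smooth_lift_self J σ
  refine ⟨(φ.restrictScalars R).comp Algebra.TensorProduct.includeRight, ?_⟩
  ext a
  have h1 := hφ (Algebra.TensorProduct.includeRight a)
  have h2 : σ (Algebra.TensorProduct.includeRight a) = f a := by simp [σ]
  rw [h2] at h1
  exact h1
end

section
/- Let R be a commutative ring and let A be a smooth R-algebra, i.e., of finite presentation and formally smooth over R. Then there exist a smooth R-algebra C whose module of Kähler differentials Ω_{C/R} is a free C-module, together with R-algebra homomorphisms φ : A → C and ψ : C → A with ψ ∘ φ = id_A; that is, A is a retract of C in the category of R-algebras, where C has free Kähler differentials. (Lemma 5.4, affine-algebraic form) -/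
universe u
open TensorProduct KaehlerDifferential
theorem sym_smooth (A Q : Type u) [CommRing A] [AddCommGroup Q] [Module A Q] [Module.Projective A Q] :
    Algebra.FormallySmooth A (SymmetricAlgebra A Q) := by
  refine .of_comp_surjective fun B _ _ I hI f ↦ ?_
  obtain ⟨g, hg⟩ := Module.projective_lifting_property (Ideal.Quotient.mkₐ A I).toLinearMap
    (f.toLinearMap ∘ₗ SymmetricAlgebra.ι A Q) Ideal.Quotient.mk_surjective
  refine ⟨SymmetricAlgebra.lift g, ?_⟩
  ext x
  simpa using congr($hg x)

theorem fp_retract (A B : Type u) [CommRing A] [CommRing B] [Algebra A B] (n : ℕ)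
    (r : MvPolynomial (Fin n) A →ₐ[A] B) (s : B →ₐ[A] MvPolynomial (Fin n) A)
    (h : ∀ b, r (s b) = b) : Algebra.FinitePresentation A B := by
  refine .of_surjective (f := r) (fun b ↦ ⟨s b, h b⟩) ?_
  let J := Ideal.span (Set.range fun i ↦ (MvPolynomial.X i - s (r (MvPolynomial.X i)) : MvPolynomial (Fin n) A))
  have key : (Ideal.Quotient.mkₐ A J) = ((Ideal.Quotient.mkₐ A J).comp s).comp r := by
    apply MvPolynomial.algHom_ext
    intro i
    exact Ideal.Quotient.eq.mpr (Ideal.subset_span ⟨i, rfl⟩)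
  have : RingHom.ker r.toRingHom = J := by
    apply le_antisymm
    · intro x hx
      have hx : r x = 0 := hx
      rw [← Ideal.Quotient.eq_zero_iff_mem]
      have := congr($key x)
      simpa [hx] using this
    · refine Ideal.span_le.mpr ?_
      rintro _ ⟨i, rfl⟩
      change r _ = 0
      simp [h]
  have h2 : (RingHom.ker r.toRingHom).FG := by
    rw [this]; exact Submodule.fg_span (Set.finite_range _)
  exact h2

theorem sym_fp (A Q : Type u) [CommRing A] [AddCommGroup Q] [Module A Q] (n : ℕ)
    (i : Q →ₗ[A] (Fin n → A)) (p : (Fin n → A) →ₗ[A] Q) (h : p ∘ₗ i = .id) :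
    Algebra.FinitePresentation A (SymmetricAlgebra A Q) := by
  let e := SymmetricAlgebra.equivMvPolynomial (Pi.basisFun A (Fin n))
  let r := (SymmetricAlgebra.lift (SymmetricAlgebra.ι A Q ∘ₗ p)).comp e.symm.toAlgHom
  let s := e.toAlgHom.comp (SymmetricAlgebra.lift (SymmetricAlgebra.ι A (Fin n → A) ∘ₗ i))
  refine fp_retract A _ n r s fun b ↦ ?_
  suffices r.comp s = .id A _ from congr($this b)
  ext x
  have := congr($h x)
  simp only [LinearMap.comp_apply, LinearMap.id_apply] at this
  simp [r, s, this]

noncomputable def symDer (A Q : Type u) [CommRing A] [AddCommGroup Q] [Module A Q] :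
    Derivation A (SymmetricAlgebra A Q) (SymmetricAlgebra A Q ⊗[A] Q) :=
  let S := SymmetricAlgebra A Q
  let M := S ⊗[A] Q
  let h : S →ₐ[A] TrivSqZeroExt S M := SymmetricAlgebra.lift
    ((TrivSqZeroExt.inlAlgHom A S M).toLinearMap ∘ₗ SymmetricAlgebra.ι A Q +
      (TrivSqZeroExt.inrHom S M).restrictScalars A ∘ₗ TensorProduct.mk A S Q 1)
  have h1 : (TrivSqZeroExt.fstHom A S M).comp h = .id A S := by
    ext x; simp [h]; rfl
  have h2 (x : S) : (h x).fst = x := congr($h1 x)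
  Derivation.mk' ((TrivSqZeroExt.sndHom S M).restrictScalars A ∘ₗ h.toLinearMap) (by
    intro a b
    simp [h2])

theorem symDer_ι (A Q : Type u) [CommRing A] [AddCommGroup Q] [Module A Q] (q : Q) :
    symDer A Q (SymmetricAlgebra.ι A Q q) = 1 ⊗ₜ q := by
  simp [symDer]

theorem der_ext (A Q : Type u) [CommRing A] [AddCommGroup Q] [Module A Q] {N : Type*}
    [AddCommGroup N] [Module A N] [Module (SymmetricAlgebra A Q) N]
    (D E : Derivation A (SymmetricAlgebra A Q) N)
    (h : ∀ q, D (SymmetricAlgebra.ι A Q q) = E (SymmetricAlgebra.ι A Q q)) : D = E := by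
  ext x
  induction x using SymmetricAlgebra.induction with
  | algebraMap r => simp
  | ι x => exact h x
  | mul a b ha hb => simp [ha, hb]
  | add a b ha hb => simp [ha, hb]

noncomputable def symKaehler (A Q : Type u) [CommRing A] [AddCommGroup Q] [Module A Q] :
    Ω[SymmetricAlgebra A Q⁄A] ≃ₗ[SymmetricAlgebra A Q] SymmetricAlgebra A Q ⊗[A] Q :=
  LinearEquiv.ofLinearMap (symDer A Q).liftKaehlerDifferential
    (LinearMap.liftBaseChange _ ((D A (SymmetricAlgebra A Q)).toLinearMap ∘ₗ SymmetricAlgebra.ι A Q))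
    (by ext q; simp [symDer_ι])
    (by
      apply Derivation.liftKaehlerDifferential_unique
      apply der_ext
      intro q
      simp [symDer_ι])

theorem kaehler_split (R A C : Type u) [CommRing R] [CommRing A] [CommRing C] [Algebra R A]
    [Algebra R C] [Algebra A C] [IsScalarTower R A C] [Algebra.FormallySmooth A C] :
    Nonempty (Ω[C⁄R] ≃ₗ[C] (C ⊗[A] Ω[A⁄R]) × Ω[C⁄A]) := by
  have hinj : Function.Injective (mapBaseChange R A C) := by
    rw [injective_iff_map_eq_zero]
    intro x hx
    obtain ⟨y, rfl⟩ := (Algebra.H1Cotangent.exact_δ_mapBaseChange R A C x).mp hx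
    rw [Subsingleton.elim y 0, map_zero]
  obtain ⟨l, hl⟩ := (KaehlerDifferential.map R A C C).exists_rightInverse_of_surjective
    (LinearMap.range_eq_top.mpr (KaehlerDifferential.map_surjective R A C))
  exact ⟨((exact_mapBaseChange_map R A C).splitSurjectiveEquiv hinj ⟨l, hl⟩).1⟩

theorem retract_aux (R A Q C : Type u) [CommRing R] [CommRing A] [Algebra R A]
    [Algebra.FormallySmooth R A] [Algebra.FinitePresentation R A]
    [AddCommGroup Q] [Module A Q] [CommRing C] [Algebra A C]
    (hs : Algebra.FormallySmooth A C) (hf : Algebra.FinitePresentation A C)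
    (k : Ω[C⁄A] ≃ₗ[C] C ⊗[A] Q) {n : ℕ} (e : (Fin n → A) ≃ₗ[A] Ω[A⁄R] × Q) (r : C →ₐ[A] A) :
    ∃ (C : Type u) (_ : CommRing C) (_ : Algebra R C),
      Algebra.FormallySmooth R C ∧ Algebra.FinitePresentation R C ∧
      Module.Free C (KaehlerDifferential R C) ∧
      ∃ (φ : A →ₐ[R] C) (ψ : C →ₐ[R] A), ψ.comp φ = AlgHom.id R A := by
  let : Algebra R C := ((algebraMap A C).comp (algebraMap R A)).toAlgebra
  have : IsScalarTower R A C := .of_algebraMap_eq' rfl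
  obtain ⟨e1⟩ := kaehler_split R A C
  let e2 : Ω[C⁄R] ≃ₗ[C] C ⊗[A] (Fin n → A) :=
    e1 ≪≫ₗ (LinearEquiv.prodCongr (.refl C _) k) ≪≫ₗ
      (TensorProduct.prodRight A C C Ω[A⁄R] Q).symm ≪≫ₗ (e.symm.baseChange A C _ _)
  refine ⟨C, inferInstance, inferInstance, .comp R A C, .trans R A C, .of_equiv e2.symm,
    IsScalarTower.toAlgHom R A C, r.restrictScalars R, ?_⟩
  ext a
  exact r.commutes a

/-- Lemma 5.4 (affine-algebraic form): every smooth `R`-algebra `A` is a retract, in the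
category of `R`-algebras, of a smooth `R`-algebra `C` with free Kähler differentials. -/
theorem smooth_algebra_retract_of_free_kaehler
    (R A : Type u) [CommRing R] [CommRing A] [Algebra R A]
    [Algebra.FormallySmooth R A] [Algebra.FinitePresentation R A] :
    ∃ (C : Type u) (_ : CommRing C) (_ : Algebra R C),
      Algebra.FormallySmooth R C ∧ Algebra.FinitePresentation R C ∧
      Module.Free C (KaehlerDifferential R C) ∧
      ∃ (φ : A →ₐ[R] C) (ψ : C →ₐ[R] A), ψ.comp φ = AlgHom.id R A := by
  obtain ⟨n, f, g, -, -, hfg⟩ := Module.Finite.exists_comp_eq_id_of_projective A Ω[A⁄R]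
  have hfg' (x) : f (g x) = x := congr($hfg x)
  let Q := LinearMap.ker f
  let i : Q →ₗ[A] (Fin n → A) := Q.subtype
  let p : (Fin n → A) →ₗ[A] Q := LinearMap.codRestrict Q (.id - g ∘ₗ f) (fun x ↦ by
    simp [Q, hfg'])
  have hi (q : Q) : f (i q) = 0 := q.2
  have hp (x) : i (p x) = x - g (f x) := rfl
  have hpi : p ∘ₗ i = .id := by
    ext1 q
    apply Subtype.val_injective
    change i (p (i q)) = i q
    rw [hp, hi, map_zero, sub_zero]
  let e : (Fin n → A) ≃ₗ[A] Ω[A⁄R] × Q :=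
    LinearEquiv.ofLinearMap (f.prod p) (g.coprod i)
      (by
        apply LinearMap.ext
        rintro ⟨x, q⟩
        refine Prod.ext ?_ (Subtype.val_injective ?_)
        · simp [hfg', hi]
        · change i (p (g x + i q)) = i q
          simp [hp, hfg', hi])
      (by
        apply LinearMap.ext
        intro x
        simp [hp])
  have : Module.Projective A Q := .of_split i p hpi
  exact retract_aux R A Q (SymmetricAlgebra A Q) (sym_smooth A Q) (sym_fp A Q n i p hpi)
    (symKaehler A Q) e SymmetricAlgebra.algebraMapInv
end

section
/- Let R be a commutative ring and let A be a smooth R-algebra, i.e., of finite presentation and formally smooth over R, whose module of Kähler differentials is stably free of rank d: Ω_{A/R} ⊕ A^k ≅ A^{k+d} as A-modules for some k ∈ ℕ. Then there exist n ∈ ℕ with n ≥ d, polynomials e₁, …, e_{n−d} ∈ R[x₁, …, x_n], and a commutative R-algebra Â such that R[x₁, …, x_n]/(e₁, …, e_{n−d}) ≅ A × Â as R-algebras; in other words, Spec A is a clopen summand of a complete intersection in 𝔸ⁿ_R cut out by exactly n − d equations. (Lemma A.9, affine-algebraic form) -/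
universe u

section helpers
open MvPolynomial

/-- An f.g. ideal equal to its square modulo some equations splits off as a clopen summand. -/
lemma clopen_aux {R A P : Type u} [CommRing R] [CommRing A] [Algebra R A] [CommRing P]
    [Algebra R P] (f : P →ₐ[R] A) (hf : Function.Surjective f) (hfg : (RingHom.ker f).FG)
    {ι : Type*} (e : ι → P)
    (he : RingHom.ker f = Ideal.span (Set.range e) ⊔ (RingHom.ker f) ^ 2) :
    ∃ (Ahat : Type u) (_ : CommRing Ahat) (_ : Algebra R Ahat),
      Nonempty ((P ⧸ Ideal.span (Set.range e)) ≃ₐ[R] (A × Ahat)) := by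
  set J := Ideal.span (Set.range e) with hJ
  have hle : J ≤ RingHom.ker f := by rw [he]; exact le_sup_left
  let g : P ⧸ J →ₐ[R] A := Ideal.Quotient.liftₐ J f (fun a ha => hle ha)
  have hg : Function.Surjective g := fun a => by
    obtain ⟨p, rfl⟩ := hf a
    exact ⟨Ideal.Quotient.mk J p, rfl⟩
  have hker : RingHom.ker g = (RingHom.ker f).map (Ideal.Quotient.mk J) := by
    apply le_antisymm
    · intro x hx
      obtain ⟨p, rfl⟩ := Ideal.Quotient.mk_surjective x
      exact Ideal.mem_map_of_mem _ hx
    · rw [Ideal.map_le_iff_le_comap]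
      intro x hx
      exact hx
  have hid : IsIdempotentElem (RingHom.ker g) := by
    have h2 : (RingHom.ker f).map (Ideal.Quotient.mk J) =
        ((RingHom.ker f) ^ 2).map (Ideal.Quotient.mk J) := by
      conv_lhs => rw [he]
      rw [Ideal.map_sup, Ideal.map_quotient_self, bot_sup_eq]
    unfold IsIdempotentElem
    rw [hker, ← pow_two, ← Ideal.map_pow, ← h2]
  obtain ⟨c, hc, hc2⟩ := (Ideal.isIdempotentElem_iff_of_fg _ (hker ▸ hfg.map _)).mp hid
  refine ⟨(P ⧸ J) ⧸ Ideal.span {1 - c}, inferInstance, inferInstance, ⟨?_⟩⟩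
  refine (AlgEquiv.prodQuotientOfIsIdempotentElem R hc hc.one_sub (by simp)
    (by rw [mul_sub, mul_one, hc.eq, sub_self])).trans ?_
  exact AlgEquiv.prodCongr ((Ideal.quotientEquivAlgOfEq R hc2.symm).trans
    (Ideal.quotientKerAlgEquivOfSurjective hg)) AlgEquiv.refl

/-- Generators of the conormal module lift to generators of the ideal modulo its square. -/
lemma lift_aux {R A : Type u} [CommRing R] [CommRing A] [Algebra R A] (P : Algebra.Extension R A)
    {ι : Type*} (v : ι → P.Cotangent) (hv : Submodule.span A (Set.range v) = ⊤) :
    ∃ e : ι → P.Ring, P.ker = Ideal.span (Set.range e) ⊔ P.ker ^ 2 := by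
  choose w hw using fun i => Algebra.Extension.Cotangent.mk_surjective (v i)
  refine ⟨fun i => (w i : P.Ring), le_antisymm ?_ ?_⟩
  · have key : ∀ y : P.Cotangent, ∃ z : P.ker,
        (z : P.Ring) ∈ Ideal.span (Set.range fun i => (w i : P.Ring)) ∧
        Algebra.Extension.Cotangent.mk z = y := by
      intro y
      have hy : y ∈ Submodule.span A (Set.range v) := hv ▸ Submodule.mem_top
      induction hy using Submodule.span_induction with
      | mem x hx =>
        obtain ⟨i, rfl⟩ := hx
        exact ⟨w i, Ideal.subset_span ⟨i, rfl⟩, hw i⟩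
      | zero => exact ⟨0, by simp, by simp⟩
      | add x y _ _ hx hy =>
        obtain ⟨a, ha, rfl⟩ := hx
        obtain ⟨b, hb, rfl⟩ := hy
        exact ⟨a + b, by simpa using add_mem ha hb, by simp⟩
      | smul r x _ hx =>
        obtain ⟨a, ha, rfl⟩ := hx
        refine ⟨P.σ r • a, by simpa using Ideal.mul_mem_left _ _ ha, ?_⟩
        rw [map_smul, ← algebraMap_smul A (P.σ r), P.algebraMap_σ]
    intro x hx
    obtain ⟨z, hz, hzx⟩ := key (Algebra.Extension.Cotangent.mk ⟨x, hx⟩)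
    rw [eq_comm, Algebra.Extension.Cotangent.mk_eq_mk_iff_sub_mem] at hzx
    have : x = (z : P.Ring) + (x - z) := by ring
    rw [this]
    exact Submodule.add_mem_sup hz hzx
  · refine sup_le (Ideal.span_le.mpr ?_) (Ideal.pow_le_self two_ne_zero)
    rintro _ ⟨i, rfl⟩
    exact (w i).2

/-- Schanuel-type linear algebra. -/
lemma schanuel_aux {A C M W X Y Z : Type*} [CommRing A] [AddCommGroup C] [AddCommGroup M]
    [AddCommGroup W] [AddCommGroup X] [AddCommGroup Y] [AddCommGroup Z]
    [Module A C] [Module A M] [Module A W] [Module A X] [Module A Y] [Module A Z]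
    [Module.Projective A W]
    (f : C →ₗ[A] M) (g : M →ₗ[A] W) (hf : Function.Injective f) (hfg : Function.Exact f g)
    (hg : Function.Surjective g) (ψ : (X × Y) ≃ₗ[A] M) (hψ : ∀ y, g (ψ (0, y)) = 0)
    (E : (W × Z) ≃ₗ[A] Y) :
    ∃ φ : (X × Z) →ₗ[A] C, Function.Surjective φ := by
  let p : X →ₗ[A] W := g ∘ₗ ψ.toLinearMap ∘ₗ LinearMap.inl A X Y
  have hp : ∀ x y, g (ψ (x, y)) = p x := by
    intro x y
    have : ((x, y) : X × Y) = (x, 0) + (0, y) := by simp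
    rw [this, map_add, map_add, hψ, add_zero]
    rfl
  have hps : Function.Surjective p := fun w => by
    obtain ⟨m, rfl⟩ := hg w
    obtain ⟨⟨x, y⟩, rfl⟩ := ψ.surjective m
    exact ⟨x, (hp x y).symm⟩
  obtain ⟨s, hs⟩ := Module.projective_lifting_property p LinearMap.id hps
  have hs' : ∀ w, p (s w) = w := fun w => LinearMap.congr_fun hs w
  let φ₀ : (X × Z) →ₗ[A] (X × Y) :=
    LinearMap.prod ((LinearMap.id - s ∘ₗ p) ∘ₗ LinearMap.fst A X Z)
      (E.toLinearMap ∘ₗ LinearMap.prodMap p LinearMap.id)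
  have hφ₀ : ∀ x z, φ₀ (x, z) = (x - s (p x), E (p x, z)) := fun x z => rfl
  have hmem : ∀ q, ψ (φ₀ q) ∈ LinearMap.range f := by
    rintro ⟨x, z⟩
    rw [← LinearMap.exact_iff.mp hfg, LinearMap.mem_ker, hφ₀, hp, map_sub, hs', sub_self]
  let e := LinearEquiv.ofInjective f hf
  refine ⟨e.symm.toLinearMap ∘ₗ LinearMap.codRestrict _ (ψ.toLinearMap ∘ₗ φ₀) hmem, ?_⟩
  intro c
  obtain ⟨⟨x, y⟩, hxy⟩ := ψ.surjective (f c)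
  obtain ⟨⟨w, z⟩, rfl⟩ := E.surjective y
  have hx : p x = 0 := by rw [← hp x (E (w, z)), hxy, hfg.apply_apply_eq_zero]
  refine ⟨(x + s w, z), ?_⟩
  change e.symm _ = c
  rw [LinearEquiv.symm_apply_eq]
  apply Subtype.ext
  change ψ (φ₀ (x + s w, z)) = f c
  rw [hφ₀, map_add, hx, hs', zero_add, add_sub_cancel_right, hxy]

end helpers

/-- Lemma A.9 (affine-algebraic form): a smooth `R`-algebra whose Kähler differentials are
stably free of rank `d` presents `Spec A` as a clopen summand of a complete intersection in
`𝔸ⁿ_R` cut out by exactly `n - d` equations. -/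
theorem smooth_stably_free_is_clopen_summand_of_complete_intersection
    (R A : Type u) [CommRing R] [CommRing A] [Algebra R A]
    [Algebra.FormallySmooth R A] [Algebra.FinitePresentation R A] (d : ℕ)
    (hstab : ∃ k : ℕ,
      Nonempty ((KaehlerDifferential R A × (Fin k → A)) ≃ₗ[A] (Fin (k + d) → A))) :
    ∃ n : ℕ, d ≤ n ∧
      ∃ (e : Fin (n - d) → MvPolynomial (Fin n) R) (Ahat : Type u)
        (_ : CommRing Ahat) (_ : Algebra R Ahat),
        Nonempty ((MvPolynomial (Fin n) R ⧸ Ideal.span (Set.range e)) ≃ₐ[R] (A × Ahat)) := by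
  classical
  obtain ⟨k, ⟨E⟩⟩ := hstab
  obtain ⟨m, f₀, hf₀⟩ := Algebra.FiniteType.iff_quotient_mvPolynomial''.mp
    (inferInstance : Algebra.FiniteType R A)
  let val₀ : Fin m ⊕ Fin (k + d) → A := Sum.elim (fun i => f₀ (MvPolynomial.X i)) (fun _ => 0)
  let val : Fin (m + (k + d)) → A := val₀ ∘ finSumFinEquiv.symm
  have hval : Function.Surjective (MvPolynomial.aeval (R := R) val) := by
    intro a
    obtain ⟨q, rfl⟩ := hf₀ a
    refine ⟨MvPolynomial.rename (fun i => finSumFinEquiv (Sum.inl i)) q, ?_⟩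
    rw [MvPolynomial.aeval_rename]
    have : (val ∘ fun i => finSumFinEquiv (Sum.inl i)) = fun i => f₀ (MvPolynomial.X i) := by
      funext i
      simp [val, val₀]
    rw [this]
    exact (DFunLike.congr_fun (MvPolynomial.aeval_unique f₀) q).symm
  let P := Algebra.Generators.ofSurjective val hval
  have hinj : Function.Injective P.toExtension.cotangentComplex :=
    (Algebra.Extension.subsingleton_h1Cotangent P.toExtension).mp P.equivH1Cotangent.subsingleton
  let b : Module.Basis (Fin m ⊕ Fin (k + d)) A P.toExtension.CotangentSpace :=
    P.cotangentSpaceBasis.reindex finSumFinEquiv.symm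
  let ψ : ((Fin m → A) × (Fin (k + d) → A)) ≃ₗ[A] P.toExtension.CotangentSpace :=
    (LinearEquiv.sumArrowLequivProdArrow (Fin m) (Fin (k + d)) A A).symm.trans b.equivFun.symm
  have hψ : ∀ y, P.toExtension.toKaehler (ψ (0, y)) = 0 := by
    intro y
    have : ψ (0, y) = ∑ i, y i • P.cotangentSpaceBasis (finSumFinEquiv (Sum.inr i)) := by
      simp [ψ, b, Module.Basis.equivFun_symm_apply]
    rw [this, map_sum]
    refine Finset.sum_eq_zero fun i _ => ?_
    rw [map_smul, Algebra.Generators.toKaehler_cotangentSpaceBasis]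
    have : P.val (finSumFinEquiv (Sum.inr i)) = 0 := by
      simp [P, val, val₀]
    rw [this, map_zero, smul_zero]
  obtain ⟨φ, hφ⟩ := schanuel_aux P.toExtension.cotangentComplex P.toExtension.toKaehler hinj
    P.toExtension.exact_cotangentComplex_toKaehler P.toExtension.toKaehler_surjective ψ hψ E
  have hn : m + (k + d) - d = m + k := by omega
  let ρ : Fin (m + (k + d) - d) ≃ Fin m ⊕ Fin k := (finCongr hn).trans finSumFinEquiv.symm
  let B : Module.Basis (Fin (m + (k + d) - d)) A ((Fin m → A) × (Fin k → A)) :=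
    ((Pi.basisFun A (Fin m)).prod (Pi.basisFun A (Fin k))).reindex ρ.symm
  obtain ⟨e, he⟩ := lift_aux P.toExtension (fun i => φ (B i)) (by
    have : (fun i => φ (B i)) = φ ∘ B := rfl
    rw [this, Set.range_comp, ← Submodule.map_span, B.span_eq, Submodule.map_top,
      LinearMap.range_eq_top.mpr hφ])
  refine ⟨m + (k + d), by omega, e, ?_⟩
  have hfg := Algebra.FinitePresentation.ker_fg_of_mvPolynomial (MvPolynomial.aeval (R := R) val) hval
  exact clopen_aux (MvPolynomial.aeval (R := R) val) hval hfg e he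
end

section
/- Let S be a nonzero commutative ring and let f ∈ S be a unit. Let L be the localization of the polynomial ring S[t] away from the element f·t − 1. Then the canonical map on unit groups (S[t])ˣ → Lˣ is not surjective; specifically, f·t − 1 becomes a unit in L which is not in the image of (S[t])ˣ. (Key computation in Example 13.2) -/
open Polynomial

/-- Example 13.2 (key computation): for a nonzero commutative ring `S` and a unit `f ∈ S`,
the map on unit groups from `S[t]` to the localization of `S[t]` away from `f·t − 1` is
not surjective; indeed `f·t − 1` becomes a unit which is not in the image of `(S[t])ˣ`. -/
theorem units_map_localization_away_ft_sub_one_not_surjective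
    (S : Type*) [CommRing S] [Nontrivial S] (f : S) (hf : IsUnit f) :
    ¬ Function.Surjective
        ⇑(Units.map (algebraMap (Polynomial S)
            (Localization.Away (C f * X - 1))).toMonoidHom) ∧
      IsUnit (algebraMap (Polynomial S) (Localization.Away (C f * X - 1))
        (C f * X - 1)) ∧
      ∀ u : (Polynomial S)ˣ,
        algebraMap (Polynomial S) (Localization.Away (C f * X - 1)) ↑u ≠
          algebraMap (Polynomial S) (Localization.Away (C f * X - 1)) (C f * X - 1) := by
  obtain ⟨g, rfl⟩ := hf
  have hp : (C (g : S) * X - 1 : S[X]) = C (g : S) * (X - C ((g⁻¹ : Sˣ) : S)) := by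
    rw [mul_sub, ← C_mul, Units.mul_inv, C_1]
  have hnzd : (C (g : S) * X - 1 : S[X]) ∈ nonZeroDivisors S[X] := by
    rw [hp]
    exact mul_mem (g.isUnit.map C).mem_nonZeroDivisors (monic_X_sub_C _).mem_nonZeroDivisors
  have hinj : Function.Injective
      (algebraMap (Polynomial S) (Localization.Away (C (g : S) * X - 1 : S[X]))) :=
    IsLocalization.injective _ (Submonoid.powers_le.mpr hnzd)
  have hunit : IsUnit (algebraMap (Polynomial S)
      (Localization.Away (C (g : S) * X - 1 : S[X])) (C (g : S) * X - 1)) :=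
    IsLocalization.Away.algebraMap_isUnit _
  have hne : ∀ u : (Polynomial S)ˣ,
      algebraMap (Polynomial S) (Localization.Away (C (g : S) * X - 1 : S[X])) ↑u ≠
        algebraMap (Polynomial S) (Localization.Away (C (g : S) * X - 1 : S[X]))
          (C (g : S) * X - 1) := by
    intro u hu
    have h1 : (u : S[X]) = C (g : S) * X - 1 := hinj hu
    have h2 : IsUnit (evalRingHom ((g⁻¹ : Sˣ) : S) (u : S[X])) := u.isUnit.map _
    rw [h1] at h2
    simp at h2
  refine ⟨fun hs => ?_, hunit, hne⟩
  obtain ⟨u, hu⟩ := hs hunit.unit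
  exact hne u (congrArg Units.val hu)
end

section
/- Let A be a commutative ring and n ∈ ℕ. For every matrix E in the subgroup E_n(A) of GL_n(A) generated by the elementary (transvection) matrices, there exists an invertible matrix M ∈ GL_n(A[λ]) over the polynomial ring A[λ] such that evaluating at λ = 0 gives M(0) = E and evaluating at λ = 1 gives M(1) = 1 (the identity matrix); that is, every element of E_n(A) is naively 𝔸¹-homotopic to the identity through invertible matrices. (Core of Lemma 8.3) -/
open Polynomial Matrix

/-- Core of Lemma 8.3: every matrix in the subgroup of `GL_n(A)` generated by the
elementary (transvection) matrices is naively `𝔸¹`-homotopic to the identity through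
invertible matrices: there is `M ∈ GL_n(A[λ])` with `M(0) = E` and `M(1) = 1`. -/
theorem elementary_matrix_A1_homotopic_to_identity
    (A : Type*) [CommRing A] (n : ℕ)
    (E : (Matrix (Fin n) (Fin n) A)ˣ)
    (hE : E ∈ Subgroup.closure {T : (Matrix (Fin n) (Fin n) A)ˣ |
      ∃ (i j : Fin n) (_ : i ≠ j) (c : A),
        (T : Matrix (Fin n) (Fin n) A) = Matrix.transvection i j c}) :
    ∃ M : (Matrix (Fin n) (Fin n) (Polynomial A))ˣ,
      Units.map ((Polynomial.evalRingHom (0 : A)).mapMatrix).toMonoidHom M = E ∧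
      Units.map ((Polynomial.evalRingHom (1 : A)).mapMatrix).toMonoidHom M = 1 := by
  induction hE using Subgroup.closure_induction with
  | mem T hT =>
    obtain ⟨i, j, hij, c, hT⟩ := hT
    refine ⟨⟨transvection i j (C c * (1 - X)), transvection i j (-(C c * (1 - X))), ?_, ?_⟩,
      ?_, ?_⟩
    · rw [transvection_mul_transvection_same _ _ hij, add_neg_cancel, transvection_zero]
    · rw [transvection_mul_transvection_same _ _ hij, neg_add_cancel, transvection_zero]
    · apply Units.ext
      rw [hT]
      change (Polynomial.evalRingHom (0 : A)).mapMatrix (transvection i j (C c * (1 - X))) = _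
      rw [transvection, transvection, map_add, map_one]
      rw [RingHom.mapMatrix_apply, Matrix.map_single]
      simp
    · apply Units.ext
      change (Polynomial.evalRingHom (1 : A)).mapMatrix (transvection i j (C c * (1 - X))) = 1
      rw [transvection, map_add, map_one]
      rw [RingHom.mapMatrix_apply, Matrix.map_single]
      simp
  | one => exact ⟨1, map_one _, map_one _⟩
  | mul x y _ _ hx hy =>
    obtain ⟨M, h0, h1⟩ := hx
    obtain ⟨N, k0, k1⟩ := hy
    exact ⟨M * N, by rw [map_mul, h0, k0], by rw [map_mul, h1, k1, one_mul]⟩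
  | inv x _ hx =>
    obtain ⟨M, h0, h1⟩ := hx
    exact ⟨M⁻¹, by rw [map_inv, h0], by rw [map_inv, h1, inv_one]⟩
end
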